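/- arXiv:2410.12364 — 3 statements merged into one kernel-verified Lean document; each statement's English description precedes it below -/
import Mathlib

section
/- For every t > 0 and h > 0, the enriched free energy F_N(t,h) of the SK model is differentiable in t and in h, with ∂_t F_N(t,h) = E⟨((σ·σ')/N)²⟩ and ∂_h F_N(t,h) = E⟨(σ·σ')/N⟩, where σ, σ' are two independent samples from the Gibbs measure with weights proportional to exp(H_N(t,h,σ)). -/
open MeasureTheory ProbabilityTheory Real Filter
open scoped NNReal

/-- The law of the randomness of the enriched SK model: i.i.d. standard Gaussian
coefficients `(W_{ij})_{1 ≤ i,j ≤ N}` together with an independent vector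
`z = (z_1, …, z_N)` of i.i.d. standard Gaussians. -/
noncomputable def measWZ (N : ℕ) : Measure (((Fin N × Fin N) → ℝ) × (Fin N → ℝ)) :=
  (Measure.pi fun _ : Fin N × Fin N => gaussianReal 0 1).prod
    (Measure.pi fun _ : Fin N => gaussianReal 0 1)

/-- The Sherrington–Kirkpatrick Hamiltonian. -/
noncomputable def HSK (N : ℕ) (W : (Fin N × Fin N) → ℝ) (σ : Fin N → ℝ) : ℝ :=
  (1 / Real.sqrt N) * ∑ i : Fin N, ∑ j : Fin N, W (i, j) * σ i * σ j

/-- The enriched SK Hamiltonian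
`H_N(t,h,σ) = √(2t) H_N(σ) − Nt + √(2h) z·σ − Nh`. -/
noncomputable def Henr (N : ℕ) (t h : ℝ) (ω : ((Fin N × Fin N) → ℝ) × (Fin N → ℝ))
    (σ : Fin N → ℝ) : ℝ :=
  Real.sqrt (2 * t) * HSK N ω.1 σ - N * t
    + Real.sqrt (2 * h) * (∑ i : Fin N, ω.2 i * σ i) - N * h

/-- The partition function of the enriched SK model. -/
noncomputable def Zenr (N : ℕ) (t h : ℝ)
    (ω : ((Fin N × Fin N) → ℝ) × (Fin N → ℝ)) : ℝ :=
  ∑ σ : Fin N → ({-1, 1} : Finset ℝ), Real.exp (Henr N t h ω fun i => (σ i : ℝ))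

/-- The enriched free energy `F_N(t,h) = −N^{-1} E[log ∑_σ exp(H_N(t,h,σ))]`. -/
noncomputable def Fenr (N : ℕ) (t h : ℝ) : ℝ :=
  -(1 / N) * ∫ ω, Real.log (Zenr N t h ω) ∂(measWZ N)

/-- The averaged Gibbs bracket `E⟨f((σ·σ')/N)⟩` of a function of the overlap of two
independent samples `σ, σ'` from the Gibbs measure with weights proportional to
`exp(H_N(t,h,σ))`. -/
noncomputable def gibbsOverlap (N : ℕ) (t h : ℝ) (f : ℝ → ℝ) : ℝ :=
  ∫ ω, (∑ σ : Fin N → ({-1, 1} : Finset ℝ), ∑ σ' : Fin N → ({-1, 1} : Finset ℝ),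
      f ((∑ i : Fin N, (σ i : ℝ) * (σ' i : ℝ)) / N) *
        Real.exp (Henr N t h ω (fun i => (σ i : ℝ)) + Henr N t h ω fun i => (σ' i : ℝ)))
    / (Zenr N t h ω) ^ 2 ∂(measWZ N)

/-- **Gaussian integration by parts** (Stein's identity) in dimension one. -/
theorem integral_mul_gaussianReal_eq_integral_deriv {f f' : ℝ → ℝ} {C C' : ℝ}
    (hf : ∀ x, HasDerivAt f (f' x) x) (hf' : Measurable f')
    (hC : ∀ x, |f x| ≤ C) (hC' : ∀ x, |f' x| ≤ C') :
    ∫ x, x * f x ∂(gaussianReal 0 1) = ∫ x, f' x ∂(gaussianReal 0 1) := by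
  have hfm : Measurable f :=
    (continuous_iff_continuousAt.2 fun x => (hf x).continuousAt).measurable
  have hγ : gaussianReal 0 1 = (volume : Measure ℝ).withDensity (gaussianPDF 0 1) :=
    gaussianReal_of_var_ne_zero 0 one_ne_zero
  have htr : ∀ {g : ℝ → ℝ}, Integrable g (gaussianReal 0 1) →
      Integrable fun x => gaussianPDFReal 0 1 x * g x := by
    intro g hg
    rw [hγ, integrable_withDensity_iff_integrable_smul' (measurable_gaussianPDF 0 1)
      (ae_of_all _ fun _ => gaussianPDF_lt_top)] at hg
    simpa [toReal_gaussianPDF] using hg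
  have hid : Integrable (fun x : ℝ => x) (gaussianReal 0 1) :=
    (memLp_id_gaussianReal (μ := 0) (v := 1) 1).integrable le_rfl
  have hfi : Integrable f (gaussianReal 0 1) :=
    Integrable.of_bound hfm.aestronglyMeasurable C (ae_of_all _ hC)
  have hxfi : Integrable (fun x => x * f x) (gaussianReal 0 1) :=
    hid.mul_bdd hfm.aestronglyMeasurable (ae_of_all _ hC)
  have hf'i : Integrable f' (gaussianReal 0 1) :=
    Integrable.of_bound hf'.aestronglyMeasurable C' (ae_of_all _ hC')
  have hpdf : ∀ x, HasDerivAt (gaussianPDFReal 0 1) (-x * gaussianPDFReal 0 1 x) x := by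
    intro x
    have h1 : HasDerivAt (fun y : ℝ => -(y - 0) ^ 2 / (2 * ((1 : ℝ≥0) : ℝ))) (-x) x := by
      have := (((hasDerivAt_id x).sub_const 0).pow 2).neg.div_const (2 * ((1 : ℝ≥0) : ℝ))
      refine this.congr_deriv ?_
      simp only [id, NNReal.coe_one]
      norm_num
      ring
    have h2 := h1.exp.const_mul (√(2 * π * ((1 : ℝ≥0) : ℝ)))⁻¹
    refine h2.congr_deriv ?_
    simp only [gaussianPDFReal]
    ring
  have key := integral_mul_deriv_eq_deriv_mul_of_integrable (u := f) (u' := f')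
    (v := gaussianPDFReal 0 1) (v' := fun x => -x * gaussianPDFReal 0 1 x)
    (fun x _ => hf x) (fun x _ => hpdf x)
    ((htr hxfi).neg.congr (ae_of_all _ fun x => by simp only [Pi.neg_apply, Pi.mul_apply]; ring))
    ((htr hf'i).congr (ae_of_all _ fun x => by simp only [Pi.mul_apply]; ring))
    ((htr hfi).congr (ae_of_all _ fun x => by simp only [Pi.mul_apply]; ring))
  rw [integral_gaussianReal_eq_integral_smul one_ne_zero,
    integral_gaussianReal_eq_integral_smul one_ne_zero]
  simp only [smul_eq_mul]
  calc ∫ x, gaussianPDFReal 0 1 x * (x * f x)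
      = -∫ x, f x * (-x * gaussianPDFReal 0 1 x) := by
        rw [← integral_neg]; congr 1; ext x; ring
    _ = ∫ x, gaussianPDFReal 0 1 x * f' x := by
        rw [key, neg_neg]; congr 1; ext x; ring

/-- Resampling one coordinate preserves a product of probability measures. -/
theorem measurePreserving_update_pi {ι : Type*} [Fintype ι] [DecidableEq ι] {X : ι → Type*}
    [∀ i, MeasurableSpace (X i)] (μ : ∀ i, Measure (X i)) [∀ i, IsProbabilityMeasure (μ i)]
    (i : ι) :
    MeasurePreserving (fun p : (∀ j, X j) × X i => Function.update p.1 i p.2)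
      ((Measure.pi μ).prod (μ i)) (Measure.pi μ) := by
  refine ⟨measurable_update', (Measure.pi_eq fun s hs => ?_).symm⟩
  rw [Measure.map_apply measurable_update' (MeasurableSet.univ_pi hs)]
  have hpre : (fun p : (∀ j, X j) × X i => Function.update p.1 i p.2) ⁻¹' Set.univ.pi s
      = (Set.univ.pi (Function.update s i Set.univ)) ×ˢ s i := by
    ext ⟨g, x⟩
    simp only [Set.mem_preimage, Set.mem_univ_pi, Set.mem_prod]
    constructor
    · refine fun h => ⟨fun j => ?_, by simpa using h i⟩
      rcases eq_or_ne j i with rfl | hj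
      · simp
      · simpa [hj] using h j
    · rintro ⟨h, hx⟩ j
      rcases eq_or_ne j i with rfl | hj
      · simpa using hx
      · simpa [hj] using h j
  rw [hpre, Measure.prod_prod, Measure.pi_pi, ← Finset.mul_prod_erase _ _ (Finset.mem_univ i),
    ← Finset.mul_prod_erase _ (fun j => μ j (s j)) (Finset.mem_univ i)]
  rw [Finset.prod_congr rfl fun j hj => by
    rw [Function.update_of_ne (Finset.ne_of_mem_erase hj)]]
  simp [mul_comm]

theorem integrable_pi_gaussianReal_eval {ι : Type*} [Fintype ι] (i : ι) :
    Integrable (fun g : ι → ℝ => g i) (Measure.pi fun _ => gaussianReal 0 1) :=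
  (measurePreserving_eval (fun _ : ι => gaussianReal 0 1) i).integrable_comp_of_integrable
    (g := fun x : ℝ => x) ((memLp_id_gaussianReal (μ := 0) (v := 1) 1).integrable le_rfl)

/-- **Gaussian integration by parts** in one coordinate of a standard Gaussian vector, in the
presence of additional randomness. -/
theorem integral_mul_pi_gaussianReal_prod_eq_integral_deriv {ι Ω : Type*} [Fintype ι]
    [DecidableEq ι] [MeasurableSpace Ω] (ν : Measure Ω) [IsProbabilityMeasure ν] (i : ι)
    {F F' : (ι → ℝ) × Ω → ℝ} {C C' : ℝ}
    (hF : Measurable F) (hF' : Measurable F') (hC : ∀ ω, |F ω| ≤ C) (hC' : ∀ ω, |F' ω| ≤ C')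
    (hd : ∀ g w, HasDerivAt (fun x => F (Function.update g i x, w)) (F' (g, w)) (g i)) :
    ∫ ω, ω.1 i * F ω ∂((Measure.pi fun _ => gaussianReal 0 1).prod ν)
      = ∫ ω, F' ω ∂((Measure.pi fun _ => gaussianReal 0 1).prod ν) := by
  have hI : Integrable (fun ω : (ι → ℝ) × Ω => ω.1 i * F ω)
      ((Measure.pi fun _ => gaussianReal 0 1).prod ν) :=
    ((integrable_pi_gaussianReal_eval i).comp_fst ν).mul_bdd hF.aestronglyMeasurable
      (ae_of_all _ hC)
  have hI' : Integrable F' ((Measure.pi fun _ => gaussianReal 0 1).prod ν) :=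
    Integrable.of_bound hF'.aestronglyMeasurable C' (ae_of_all _ hC')
  rw [integral_prod_symm _ hI, integral_prod_symm _ hI']
  congr 1
  ext w
  have hFw : Measurable fun g => F (g, w) := hF.comp measurable_prodMk_right
  have hFw' : Measurable fun g => F' (g, w) := hF'.comp measurable_prodMk_right
  have hmp := measurePreserving_update_pi (fun _ : ι => gaussianReal 0 1) i
  have hJ : Integrable (fun g : ι → ℝ => g i * F (g, w)) (Measure.pi fun _ => gaussianReal 0 1) :=
    (integrable_pi_gaussianReal_eval i).mul_bdd hFw.aestronglyMeasurable
      (ae_of_all _ fun g => hC _)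
  have hJ' : Integrable (fun g : ι → ℝ => F' (g, w)) (Measure.pi fun _ => gaussianReal 0 1) :=
    Integrable.of_bound hFw'.aestronglyMeasurable C' (ae_of_all _ fun g => hC' _)
  have hresample : ∀ {G : (ι → ℝ) → ℝ}, Integrable G (Measure.pi fun _ => gaussianReal 0 1) →
      ∫ g, G g ∂(Measure.pi fun _ => gaussianReal 0 1)
        = ∫ g, ∫ x, G (Function.update g i x) ∂(gaussianReal 0 1)
            ∂(Measure.pi fun _ => gaussianReal 0 1) := by
    intro G hG
    have hG' := hG
    rw [← hmp.map_eq] at hG'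
    conv_lhs => rw [← hmp.map_eq]
    rw [integral_map hmp.measurable.aemeasurable hG'.aestronglyMeasurable,
      integral_prod (fun p : (ι → ℝ) × ℝ => G (Function.update p.1 i p.2))
        (hmp.integrable_comp_of_integrable hG)]
  rw [hresample hJ, hresample hJ']
  congr 1
  ext g
  simp only [Function.update_self]
  refine integral_mul_gaussianReal_eq_integral_deriv (C := C) (C' := C') (fun x => ?_)
    (hFw'.comp (measurable_update g)) (fun x => hC _) (fun x => hC' _)
  simpa using hd (Function.update g i x) w

/-- The Gibbs weight `exp (X σ) / ∑ τ, exp (X τ)` of the configuration `σ`. -/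
noncomputable def gibbsWeight {S : Type*} [Fintype S] (X : S → ℝ) (σ : S) : ℝ :=
  exp (X σ) / ∑ τ, exp (X τ)

section gibbsWeight

variable {S : Type*} [Fintype S]

theorem sum_exp_pos [Nonempty S] (X : S → ℝ) : 0 < ∑ τ, exp (X τ) :=
  Finset.sum_pos (fun _ _ => exp_pos _) Finset.univ_nonempty

theorem gibbsWeight_nonneg (X : S → ℝ) (σ : S) : 0 ≤ gibbsWeight X σ :=
  div_nonneg (exp_pos _).le (Finset.sum_nonneg fun _ _ => (exp_pos _).le)

theorem sum_gibbsWeight [Nonempty S] (X : S → ℝ) : ∑ σ, gibbsWeight X σ = 1 := by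
  simp only [gibbsWeight]
  rw [← Finset.sum_div, div_self (sum_exp_pos X).ne']

theorem gibbsWeight_le_one [Nonempty S] (X : S → ℝ) (σ : S) : gibbsWeight X σ ≤ 1 := by
  rw [← sum_gibbsWeight X]
  exact Finset.single_le_sum (fun τ _ => gibbsWeight_nonneg X τ) (Finset.mem_univ σ)

theorem abs_gibbsWeight_le_one [Nonempty S] (X : S → ℝ) (σ : S) : |gibbsWeight X σ| ≤ 1 := by
  rw [abs_of_nonneg (gibbsWeight_nonneg X σ)]
  exact gibbsWeight_le_one X σ

theorem abs_sum_gibbsWeight_mul_le [Nonempty S] (X f : S → ℝ) :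
    |∑ σ, gibbsWeight X σ * f σ| ≤ ∑ σ, |f σ| := by
  refine (Finset.abs_sum_le_sum_abs _ _).trans (Finset.sum_le_sum fun σ _ => ?_)
  rw [abs_mul]
  exact mul_le_of_le_one_left (abs_nonneg _) (abs_gibbsWeight_le_one X σ)

theorem measurable_gibbsWeight {Ω : Type*} [MeasurableSpace Ω] {X : Ω → S → ℝ}
    (hX : ∀ σ, Measurable fun ω => X ω σ) (σ : S) : Measurable fun ω => gibbsWeight (X ω) σ := by
  unfold gibbsWeight
  fun_prop

theorem hasDerivAt_sum_exp {X : ℝ → S → ℝ} {X' : S → ℝ} {x : ℝ}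
    (hX : ∀ σ, HasDerivAt (fun y => X y σ) (X' σ) x) :
    HasDerivAt (fun y => ∑ σ, exp (X y σ)) (∑ σ, exp (X x σ) * X' σ) x :=
  HasDerivAt.fun_sum fun σ _ => (hX σ).exp

theorem hasDerivAt_log_sum_exp [Nonempty S] {X : ℝ → S → ℝ} {X' : S → ℝ} {x : ℝ}
    (hX : ∀ σ, HasDerivAt (fun y => X y σ) (X' σ) x) :
    HasDerivAt (fun y => log (∑ σ, exp (X y σ))) (∑ σ, gibbsWeight (X x) σ * X' σ) x := by
  refine ((hasDerivAt_sum_exp hX).log (sum_exp_pos _).ne').congr_deriv ?_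
  rw [Finset.sum_div]
  refine Finset.sum_congr rfl fun σ _ => ?_
  rw [gibbsWeight, div_mul_eq_mul_div]

theorem hasDerivAt_gibbsWeight [Nonempty S] {X : ℝ → S → ℝ} {X' : S → ℝ} {x : ℝ}
    (hX : ∀ σ, HasDerivAt (fun y => X y σ) (X' σ) x) (σ : S) :
    HasDerivAt (fun y => gibbsWeight (X y) σ)
      (gibbsWeight (X x) σ * (X' σ - ∑ τ, gibbsWeight (X x) τ * X' τ)) x := by
  have hZ := (sum_exp_pos (X x)).ne'
  refine ((hX σ).exp.div (hasDerivAt_sum_exp hX) hZ).congr_deriv ?_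
  have hs : ∑ τ, gibbsWeight (X x) τ * X' τ
      = (∑ τ, exp (X x τ) * X' τ) / ∑ τ, exp (X x τ) := by
    rw [Finset.sum_div]
    refine Finset.sum_congr rfl fun τ _ => ?_
    rw [gibbsWeight, div_mul_eq_mul_div]
  rw [hs, gibbsWeight]
  field_simp

theorem abs_log_sum_exp_le [Nonempty S] (X : S → ℝ) :
    |log (∑ σ, exp (X σ))| ≤ log (Fintype.card S) + ∑ σ, |X σ| := by
  have hle : ∀ σ, |X σ| ≤ ∑ τ, |X τ| := fun σ =>
    Finset.single_le_sum (f := fun τ => |X τ|) (fun _ _ => abs_nonneg _) (Finset.mem_univ σ)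
  have hcard : (0 : ℝ) < Fintype.card S := Nat.cast_pos.2 Fintype.card_pos
  have hlog : 0 ≤ log (Fintype.card S) := log_natCast_nonneg _
  rw [abs_le]
  constructor
  · obtain ⟨σ⟩ := ‹Nonempty S›
    have h1 : exp (X σ) ≤ ∑ τ, exp (X τ) :=
      Finset.single_le_sum (f := fun τ => exp (X τ)) (fun _ _ => (exp_pos _).le)
        (Finset.mem_univ σ)
    have h2 := log_le_log (exp_pos _) h1
    rw [log_exp] at h2
    linarith [neg_abs_le (X σ), hle σ]
  · have h1 : ∑ σ, exp (X σ) ≤ Fintype.card S * exp (∑ τ, |X τ|) := by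
      refine (Finset.sum_le_card_nsmul _ _ (exp (∑ τ, |X τ|)) fun σ _ =>
        exp_le_exp.2 ((le_abs_self _).trans (hle σ))).trans ?_
      simp
    have h2 := log_le_log (sum_exp_pos X) h1
    rwa [log_mul hcard.ne' (exp_pos _).ne', log_exp] at h2

theorem sum_sum_mul_exp_div_sq_eq_gibbsWeight (X : S → ℝ) (K : S → S → ℝ) :
    (∑ σ, ∑ τ, K σ τ * exp (X σ + X τ)) / (∑ σ, exp (X σ)) ^ 2
      = ∑ σ, ∑ τ, K σ τ * (gibbsWeight X σ * gibbsWeight X τ) := by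
  simp only [Finset.sum_div]
  refine Finset.sum_congr rfl fun σ _ => Finset.sum_congr rfl fun τ _ => ?_
  rw [gibbsWeight, gibbsWeight, exp_add, div_mul_div_comm, mul_div_assoc, sq]

end gibbsWeight

section interpolation

variable {ι S Ω : Type*} [Fintype ι] [Fintype S] [Nonempty S] [MeasurableSpace Ω]
  (ν : Measure Ω) [IsProbabilityMeasure ν] (a : S → ι → ℝ) {B : S → Ω → ℝ}

/-- Gaussian integration by parts for the Gibbs average of a linear energy. -/
theorem integral_sum_gibbsWeight_mul_energy (hB : ∀ σ, Measurable (B σ)) {c : ℝ}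
    (hc : ∀ σ, ∑ i, a σ i ^ 2 = c) {r : ℝ} (d : ℝ) :
    let w : (ι → ℝ) × Ω → S → ℝ := fun ω =>
      gibbsWeight fun σ => r * (∑ i, a σ i * ω.1 i) + B σ ω.2 - d
    ∫ ω, ∑ σ, w ω σ * ∑ i, a σ i * ω.1 i ∂((Measure.pi fun _ => gaussianReal 0 1).prod ν)
      = r * ∫ ω, (c - ∑ σ, ∑ τ, (∑ i, a σ i * a τ i) * (w ω σ * w ω τ))
          ∂((Measure.pi fun _ => gaussianReal 0 1).prod ν) := by
  classical
  intro w
  set μ := (Measure.pi fun _ : ι => gaussianReal 0 1).prod ν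
  have hwm : ∀ σ, Measurable fun ω => w ω σ := fun σ =>
    measurable_gibbsWeight (fun σ => by have := hB σ; fun_prop) σ
  have hw1 : ∀ σ ω, |w ω σ| ≤ 1 := fun σ ω => abs_gibbsWeight_le_one _ σ
  let D : S → ι → (ι → ℝ) × Ω → ℝ := fun σ i ω =>
    w ω σ * (r * a σ i - ∑ τ, w ω τ * (r * a τ i))
  have hDm : ∀ σ i, Measurable (D σ i) := fun σ i => by fun_prop
  have hDb : ∀ σ i ω, |D σ i ω| ≤ |r * a σ i| + ∑ τ, |r * a τ i| := by
    intro σ i ω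
    rw [abs_mul]
    refine (mul_le_of_le_one_left (abs_nonneg _) (hw1 σ ω)).trans ((abs_sub _ _).trans ?_)
    exact add_le_add_right (abs_sum_gibbsWeight_mul_le _ _) _
  have hDi : ∀ σ i, Integrable (D σ i) μ := fun σ i =>
    Integrable.of_bound (hDm σ i).aestronglyMeasurable _ (ae_of_all _ (hDb σ i))
  have hgi : ∀ σ i, Integrable (fun ω => ω.1 i * w ω σ) μ := fun σ i =>
    ((integrable_pi_gaussianReal_eval i).comp_fst ν).mul_bdd (hwm σ).aestronglyMeasurable
      (ae_of_all _ (hw1 σ))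
  have hstein : ∀ σ i, ∫ ω, ω.1 i * w ω σ ∂μ = ∫ ω, D σ i ω ∂μ := by
    intro σ i
    refine integral_mul_pi_gaussianReal_prod_eq_integral_deriv ν i (hwm σ) (hDm σ i) (hw1 σ)
      (hDb σ i) fun g y => ?_
    have hX : ∀ τ, HasDerivAt
        (fun x => r * (∑ j, a τ j * Function.update g i x j) + B τ y - d) (r * a τ i) (g i) := by
      intro τ
      have hu : ∀ j, HasDerivAt (fun x => a τ j * Function.update g i x j)
          (a τ j * (Pi.single i 1 : ι → ℝ) j) (g i) := fun j =>
        (hasDerivAt_pi.1 (hasDerivAt_update g i (g i)) j).const_mul _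
      have hsum := HasDerivAt.fun_sum (u := Finset.univ) fun j _ => hu j
      refine (((hsum.const_mul r).add_const (B τ y)).sub_const d).congr_deriv ?_
      simp [Pi.single_apply]
    have := hasDerivAt_gibbsWeight hX σ
    simpa [w, D] using this
  calc ∫ ω, ∑ σ, w ω σ * ∑ i, a σ i * ω.1 i ∂μ
      = ∫ ω, ∑ σ, ∑ i, a σ i * (ω.1 i * w ω σ) ∂μ := by
        congr 1; ext ω
        refine Finset.sum_congr rfl fun σ _ => ?_
        rw [Finset.mul_sum]
        exact Finset.sum_congr rfl fun i _ => by ring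
    _ = ∑ σ, ∑ i, a σ i * ∫ ω, D σ i ω ∂μ := by
        rw [integral_finsetSum _ fun σ _ =>
          integrable_finsetSum _ fun i _ => (hgi σ i).const_mul _]
        refine Finset.sum_congr rfl fun σ _ => ?_
        rw [integral_finsetSum _ fun i _ => (hgi σ i).const_mul _]
        refine Finset.sum_congr rfl fun i _ => ?_
        rw [integral_const_mul, hstein]
    _ = ∫ ω, ∑ σ, ∑ i, a σ i * D σ i ω ∂μ := by
        rw [integral_finsetSum _ fun σ _ =>
          integrable_finsetSum _ fun i _ => (hDi σ i).const_mul _]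
        refine Finset.sum_congr rfl fun σ _ => ?_
        rw [integral_finsetSum _ fun i _ => (hDi σ i).const_mul _]
        exact Finset.sum_congr rfl fun i _ => (integral_const_mul _ _).symm
    _ = r * ∫ ω, (c - ∑ σ, ∑ τ, (∑ i, a σ i * a τ i) * (w ω σ * w ω τ)) ∂μ := by
        rw [← integral_const_mul]
        congr 1; ext ω
        have hsum : c = ∑ σ, w ω σ * ∑ i, a σ i ^ 2 := by
          simp only [hc]
          rw [← Finset.sum_mul, sum_gibbsWeight, one_mul]
        rw [hsum, ← Finset.sum_sub_distrib, Finset.mul_sum]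
        refine Finset.sum_congr rfl fun σ _ => ?_
        simp only [D, mul_sub, Finset.sum_sub_distrib, Finset.mul_sum, Finset.sum_mul]
        rw [Finset.sum_comm]
        congr 1
        · exact Finset.sum_congr rfl fun i _ => by ring
        · exact Finset.sum_congr rfl fun τ _ => Finset.sum_congr rfl fun i _ => by ring

/-- The derivative in the variance parameter of the expected log-partition function of a Gaussian
energy with constant variance. -/
theorem hasDerivAt_integral_log_sum_exp (hB : ∀ σ, Measurable (B σ))
    (hBi : ∀ σ, Integrable (B σ) ν) {c : ℝ} (hc : ∀ σ, ∑ i, a σ i ^ 2 = c) {t : ℝ} (ht : 0 < t) :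
    HasDerivAt
      (fun s => ∫ ω, log (∑ σ, exp (√(2 * s) * (∑ i, a σ i * ω.1 i) + B σ ω.2 - c * s))
        ∂((Measure.pi fun _ => gaussianReal 0 1).prod ν))
      (-∫ ω, (∑ σ, ∑ τ, (∑ i, a σ i * a τ i) *
          exp ((√(2 * t) * (∑ i, a σ i * ω.1 i) + B σ ω.2 - c * t)
            + (√(2 * t) * (∑ i, a τ i * ω.1 i) + B τ ω.2 - c * t)))
          / (∑ σ, exp (√(2 * t) * (∑ i, a σ i * ω.1 i) + B σ ω.2 - c * t)) ^ 2
        ∂((Measure.pi fun _ => gaussianReal 0 1).prod ν)) t := by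
  set μ := (Measure.pi fun _ : ι => gaussianReal 0 1).prod ν
  let A : S → (ι → ℝ) × Ω → ℝ := fun σ ω => ∑ i, a σ i * ω.1 i
  let X : ℝ → (ι → ℝ) × Ω → S → ℝ := fun s ω σ => √(2 * s) * A σ ω + B σ ω.2 - c * s
  have hAi : ∀ σ, Integrable (A σ) μ := fun σ =>
    integrable_finsetSum _ fun i _ =>
      ((integrable_pi_gaussianReal_eval i).comp_fst ν).const_mul _
  have hXm : ∀ s σ, Measurable fun ω => X s ω σ := fun s σ => by
    have := hB σ
    fun_prop
  have hXi : ∀ s σ, Integrable (fun ω => X s ω σ) μ := fun s σ =>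
    (((hAi σ).const_mul _).add ((hBi σ).comp_snd _)).sub (integrable_const _)
  have hwm : ∀ s σ, Measurable fun ω => gibbsWeight (X s ω) σ := fun s σ =>
    measurable_gibbsWeight (hXm s) σ
  have hderiv : ∀ s, 0 < s → ∀ ω σ,
      HasDerivAt (fun s => X s ω σ) (A σ ω / √(2 * s) - c) s := by
    intro s hs ω σ
    have h1 : HasDerivAt (fun s : ℝ => √(2 * s)) (1 / √(2 * s)) s := by
      refine (((hasDerivAt_id s).const_mul 2).sqrt (by simp [hs.ne'])).congr_deriv ?_
      have : √(2 * s) ≠ 0 := (sqrt_pos.2 (by positivity)).ne'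
      simp only [id]
      field_simp
    refine (((h1.mul_const (A σ ω)).add_const (B σ ω.2)).sub
      ((hasDerivAt_id s).const_mul c)).congr_deriv ?_
    ring
  have hlogm : ∀ s, Measurable fun ω => log (∑ σ, exp (X s ω σ)) := fun s => by
    have := hXm s
    fun_prop
  obtain ⟨-, hmain⟩ := hasDerivAt_integral_of_dominated_loc_of_deriv_le (μ := μ)
    (F := fun s ω => log (∑ σ, exp (X s ω σ)))
    (F' := fun s ω => ∑ σ, gibbsWeight (X s ω) σ * (A σ ω / √(2 * s) - c))
    (bound := fun ω => ∑ σ, (|A σ ω| / √t + |c|)) (x₀ := t)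
    (Ioi_mem_nhds (half_lt_self ht))
    (Eventually.of_forall fun s => (hlogm s).aestronglyMeasurable)
    (Integrable.mono' ((integrable_const (log (Fintype.card S))).add
        (integrable_finsetSum Finset.univ fun σ _ => (hXi t σ).abs))
      (hlogm t).aestronglyMeasurable
      (ae_of_all _ fun ω => by simpa using abs_log_sum_exp_le (X t ω)))
    (by
      have := hwm t
      exact Measurable.aestronglyMeasurable (by fun_prop))
    (ae_of_all _ fun ω s hs => by
      refine (abs_sum_gibbsWeight_mul_le _ _).trans (Finset.sum_le_sum fun σ _ => ?_)
      refine (abs_sub _ _).trans (add_le_add_left ?_ _)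
      have hs' : t / 2 < s := hs
      rw [abs_div, abs_of_nonneg (sqrt_nonneg (2 * s))]
      exact div_le_div_of_nonneg_left (abs_nonneg _) (sqrt_pos.2 ht)
        (sqrt_le_sqrt (by linarith)))
    (integrable_finsetSum _ fun σ _ => ((hAi σ).abs.div_const _).add (integrable_const _))
    (ae_of_all _ fun ω s hs =>
      hasDerivAt_log_sum_exp (hderiv s ((half_pos ht).trans hs) ω))
  refine hmain.congr_deriv ?_
  have hr : √(2 * t) ≠ 0 := (sqrt_pos.2 (by positivity)).ne'
  have hibp := integral_sum_gibbsWeight_mul_energy ν a hB hc (r := √(2 * t)) (c * t)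
  have hEi : Integrable (fun ω => ∑ σ, gibbsWeight (X t ω) σ * A σ ω) μ :=
    integrable_finsetSum _ fun σ _ =>
      (hAi σ).bdd_mul (hwm t σ).aestronglyMeasurable
        (ae_of_all _ fun ω => abs_gibbsWeight_le_one (X t ω) σ)
  have hKi : Integrable (fun ω => ∑ σ, ∑ τ, (∑ i, a σ i * a τ i) *
      (gibbsWeight (X t ω) σ * gibbsWeight (X t ω) τ)) μ :=
    integrable_finsetSum _ fun σ _ => integrable_finsetSum _ fun τ _ =>
      (Integrable.of_bound ((hwm t σ).mul (hwm t τ)).aestronglyMeasurable 1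
        (ae_of_all _ fun ω => by
          rw [Pi.mul_apply, norm_mul]
          exact mul_le_one₀ (abs_gibbsWeight_le_one _ σ) (norm_nonneg _)
            (abs_gibbsWeight_le_one _ τ))).const_mul _
  calc ∫ ω, ∑ σ, gibbsWeight (X t ω) σ * (A σ ω / √(2 * t) - c) ∂μ
      = ∫ ω, ((√(2 * t))⁻¹ * (∑ σ, gibbsWeight (X t ω) σ * A σ ω) - c) ∂μ := by
        congr 1; ext ω
        simp only [mul_sub, Finset.sum_sub_distrib]
        rw [← Finset.sum_mul, sum_gibbsWeight, one_mul, Finset.mul_sum]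
        congr 1
        exact Finset.sum_congr rfl fun σ _ => by ring
    _ = (√(2 * t))⁻¹ * (∫ ω, ∑ σ, gibbsWeight (X t ω) σ * A σ ω ∂μ) - c := by
        rw [integral_sub (hEi.const_mul _) (integrable_const _), integral_const_mul]
        simp [μ]
    _ = -∫ ω, ∑ σ, ∑ τ, (∑ i, a σ i * a τ i) *
          (gibbsWeight (X t ω) σ * gibbsWeight (X t ω) τ) ∂μ := by
        rw [show ∫ ω, ∑ σ, gibbsWeight (X t ω) σ * A σ ω ∂μ = _ from hibp,
          inv_mul_cancel_left₀ hr, integral_sub (integrable_const _) hKi]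
        simp [μ, X, A]
    _ = _ := by
        congr 2; ext ω
        exact (sum_sum_mul_exp_div_sq_eq_gibbsWeight (X t ω) _).symm

end interpolation

section SherringtonKirkpatrick

variable {N : ℕ}

theorem mul_self_sign (s : ({-1, 1} : Finset ℝ)) : (s : ℝ) * s = 1 := by
  have := s.2
  rw [Finset.mem_insert, Finset.mem_singleton] at this
  rcases this with h | h <;> rw [h] <;> norm_num

theorem integrable_HSK (N : ℕ) (σ : Fin N → ℝ) :
    Integrable (fun W => HSK N W σ) (Measure.pi fun _ => gaussianReal 0 1) :=
  (integrable_finsetSum _ fun i _ => integrable_finsetSum _ fun j _ =>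
    ((integrable_pi_gaussianReal_eval (i, j)).mul_const _).mul_const _).const_mul _

theorem sum_mul_coupling_mul_coupling (σ τ : Fin N → ({-1, 1} : Finset ℝ)) :
    ∑ p : Fin N × Fin N, 1 / √N * ((σ p.1 : ℝ) * σ p.2) * (1 / √N * ((τ p.1 : ℝ) * τ p.2))
      = (∑ i, (σ i : ℝ) * τ i) ^ 2 / N := by
  have hN : (√(N : ℝ))⁻¹ * (√N)⁻¹ = (N : ℝ)⁻¹ := by
    rw [← mul_inv, mul_self_sqrt N.cast_nonneg]
  rw [Fintype.sum_prod_type, sq, Finset.sum_mul_sum, Finset.sum_div]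
  refine Finset.sum_congr rfl fun i _ => ?_
  rw [Finset.sum_div]
  refine Finset.sum_congr rfl fun j _ => ?_
  rw [div_eq_mul_inv _ (N : ℝ), ← hN]
  ring

/-- The enriched Hamiltonian as a linear function of the couplings `W`. -/
theorem Henr_eq_coupling (s h : ℝ) (ω : ((Fin N × Fin N) → ℝ) × (Fin N → ℝ))
    (σ : Fin N → ({-1, 1} : Finset ℝ)) :
    Henr N s h ω (fun i => (σ i : ℝ))
      = √(2 * s) * (∑ p : Fin N × Fin N, 1 / √N * ((σ p.1 : ℝ) * σ p.2) * ω.1 p)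
        + (√(2 * h) * (∑ i, ω.2 i * (σ i : ℝ)) - N * h) - N * s := by
  have : HSK N ω.1 (fun i => (σ i : ℝ))
      = ∑ p : Fin N × Fin N, 1 / √N * ((σ p.1 : ℝ) * σ p.2) * ω.1 p := by
    simp only [HSK, Fintype.sum_prod_type, Finset.mul_sum]
    exact Finset.sum_congr rfl fun i _ => Finset.sum_congr rfl fun j _ => by ring
  rw [Henr, this]
  ring

/-- The enriched Hamiltonian as a linear function of the external field `z`. -/
theorem Henr_eq_field (t g : ℝ) (ω : (Fin N → ℝ) × ((Fin N × Fin N) → ℝ))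
    (σ : Fin N → ({-1, 1} : Finset ℝ)) :
    Henr N t g ω.swap (fun i => (σ i : ℝ))
      = √(2 * g) * (∑ i, (σ i : ℝ) * ω.1 i)
        + (√(2 * t) * HSK N ω.2 (fun i => (σ i : ℝ)) - N * t) - N * g := by
  simp only [Henr, Prod.fst_swap, Prod.snd_swap, mul_comm (ω.1 _)]
  ring

end SherringtonKirkpatrick

/-- For every `t > 0` and `h > 0`, the enriched free energy `F_N(t,h)` of the SK model is
differentiable in `t` and in `h`, with `∂ₜF_N(t,h) = E⟨((σ·σ')/N)²⟩` and
`∂ₕF_N(t,h) = E⟨(σ·σ')/N⟩`. -/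
theorem enriched_free_energy_derivatives (N : ℕ) (hN : 1 ≤ N) (t h : ℝ)
    (ht : 0 < t) (hh : 0 < h) :
    HasDerivAt (fun s => Fenr N s h) (gibbsOverlap N t h fun R => R ^ 2) t ∧
    HasDerivAt (fun g => Fenr N t g) (gibbsOverlap N t h fun R => R) h := by
  have hN0 : (N : ℝ) ≠ 0 := Nat.cast_ne_zero.2 (by omega)
  have : Nonempty (Fin N → ({-1, 1} : Finset ℝ)) := ⟨fun _ => ⟨1, by simp⟩⟩
  refine ⟨?_, ?_⟩
  · have key := hasDerivAt_integral_log_sum_exp (Measure.pi fun _ : Fin N => gaussianReal 0 1)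
      (fun (σ : Fin N → ({-1, 1} : Finset ℝ)) (p : Fin N × Fin N) =>
        1 / √N * ((σ p.1 : ℝ) * σ p.2))
      (B := fun σ z => √(2 * h) * (∑ i, z i * (σ i : ℝ)) - N * h)
      (fun σ => by fun_prop)
      (fun σ => ((integrable_finsetSum _ fun i _ =>
        (integrable_pi_gaussianReal_eval i).mul_const _).const_mul _).sub (integrable_const _))
      (c := N) (fun σ => by
        simp only [sum_mul_coupling_mul_coupling, mul_self_sign, sq, Finset.sum_const,
          Finset.card_univ, Fintype.card_fin, nsmul_eq_mul, mul_one]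
        field_simp) ht
    simp only [← Henr_eq_coupling] at key
    refine (key.const_mul (-(1 / (N : ℝ)))).congr_deriv ?_
    rw [neg_mul_neg, ← integral_const_mul]
    refine integral_congr_ae (ae_of_all _ fun ω => ?_)
    simp only [sum_mul_coupling_mul_coupling]
    rw [← mul_div_assoc, Finset.mul_sum]
    simp only [Finset.mul_sum]
    refine congrArg₂ _ (Finset.sum_congr rfl fun σ _ => Finset.sum_congr rfl fun τ _ => ?_) rfl
    field_simp
  · have key := hasDerivAt_integral_log_sum_exp
      (Measure.pi fun _ : Fin N × Fin N => gaussianReal 0 1)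
      (fun (σ : Fin N → ({-1, 1} : Finset ℝ)) (i : Fin N) => (σ i : ℝ))
      (B := fun σ W => √(2 * t) * HSK N W (fun i => σ i) - N * t)
      (fun σ => by unfold HSK; fun_prop)
      (fun σ => ((integrable_HSK N _).const_mul _).sub (integrable_const _))
      (c := N) (fun σ => by simp [sq, mul_self_sign]) hh
    simp only [← Henr_eq_field] at key
    refine ((key.const_mul (-(1 / (N : ℝ)))).congr_deriv ?_).congr_of_eventuallyEq
      (Eventually.of_forall fun g => ?_)
    · rw [neg_mul_neg, ← integral_const_mul, gibbsOverlap, measWZ, ← integral_prod_swap]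
      refine integral_congr_ae (ae_of_all _ fun ω => ?_)
      simp only [Prod.swap_swap]
      rw [← mul_div_assoc, Finset.mul_sum]
      simp only [Finset.mul_sum]
      refine congrArg₂ _ (Finset.sum_congr rfl fun σ _ => Finset.sum_congr rfl fun τ _ => ?_) rfl
      ring
    · simp only [Fenr, measWZ]
      rw [← integral_prod_swap]
      rfl
end

section
/- Let ξ : ℝ → ℝ be continuous and suppose that for every N ≥ 1 the kernel (σ,τ) ↦ N ξ((σ·τ)/N) on ℝ^N is positive semidefinite, i.e., for every m ≥ 1, every σ¹,…,σ^m ∈ ℝ^N and every c_1,…,c_m ∈ ℝ, Σ_{a,b=1}^m c_a c_b N ξ((σ^a·σ^b)/N) ≥ 0. Then there exist nonnegative reals (a_p)_{p≥0} such that ξ(r) = Σ_{p=0}^∞ a_p r^p for every r ∈ ℝ. (Every admissible covariance function of a spin-glass model with one type of spins is a power series with nonnegative coefficients.) -/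
open Filter Topology Finset Polynomial

/-- The coordinates of the vertex of the hypercube `{-1, 1} ^ ι` whose negative coordinates are
indexed by `A`. -/
def signVector {ι : Type*} [DecidableEq ι] (A : Finset ι) (k : ι) : ℝ := if k ∈ A then -1 else 1

lemma signVector_symmDiff {ι : Type*} [DecidableEq ι] (A B : Finset ι) (k : ι) :
    signVector (symmDiff A B) k = signVector A k * signVector B k := by
  by_cases hA : k ∈ A <;> by_cases hB : k ∈ B <;> simp [signVector, Finset.mem_symmDiff, hA, hB]

lemma sum_signVector {ι : Type*} [Fintype ι] [DecidableEq ι] (A : Finset ι) :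
    ∑ k, signVector A k = Fintype.card ι - 2 * #A := by
  have h (k : ι) : signVector A k = 1 - 2 * (if k ∈ A then 1 else 0) := by
    unfold signVector; split_ifs <;> norm_num
  simp [h, Finset.sum_sub_distrib, mul_comm]

lemma prod_one_add_signVector_mul {ι : Type*} [Fintype ι] [DecidableEq ι] (A : Finset ι) (r : ℝ) :
    ∏ k, (1 + signVector A k * r) = (1 - r) ^ #A * (1 + r) ^ (Fintype.card ι - #A) := by
  have h (k : ι) : 1 + signVector A k * r = if k ∈ A then 1 - r else 1 + r := by
    unfold signVector; split_ifs <;> ring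
  simp only [h, Finset.prod_ite, Finset.prod_const]
  congr 2
  · simp
  · rw [← Finset.card_compl]
    congr 1
    ext; simp

/-- If the kernel `(σ, τ) ↦ g (σ·τ)` is positive semidefinite on the hypercube, then the Walsh
coefficients of `A ↦ g (∑ k, signVector A k)` are nonnegative. -/
lemma walsh_coeff_nonneg {ι : Type*} [Fintype ι] [DecidableEq ι] (g : ℝ → ℝ)
    (hg : ∀ c : Finset ι → ℝ,
      0 ≤ ∑ A, ∑ B, c A * c B * g (∑ k, signVector A k * signVector B k)) (S : Finset ι) :
    0 ≤ ∑ A : Finset ι, (∏ k ∈ S, signVector A k) * g (∑ k, signVector A k) := by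
  have h := hg fun A => ∏ k ∈ S, signVector A k
  have key (A : Finset ι) :
      ∑ B : Finset ι, (∏ k ∈ S, signVector A k) * (∏ k ∈ S, signVector B k) *
          g (∑ k, signVector A k * signVector B k) =
        ∑ B : Finset ι, (∏ k ∈ S, signVector B k) * g (∑ k, signVector B k) := by
    simp only [← Finset.prod_mul_distrib, ← signVector_symmDiff]
    have hinv : Function.Involutive (fun B : Finset ι => symmDiff A B) :=
      fun B => symmDiff_symmDiff_cancel_left A B
    exact Equiv.sum_comp hinv.toPerm
      fun B : Finset ι => (∏ k ∈ S, signVector B k) * g (∑ k, signVector B k)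
  simp only [key, Finset.sum_const, nsmul_eq_mul] at h
  exact (mul_nonneg_iff_of_pos_left (by simp)).1 h

/-- The Bernstein polynomial of a function `g` on `[-N, N]`, as an average over the
hypercube. -/
lemma sum_bernstein_eq_sum_signVector (N : ℕ) (g : ℝ → ℝ) (r : ℝ) :
    ∑ k : Fin (N + 1), (N.choose k * ((1 - r) / 2) ^ (k : ℕ) *
        (1 - (1 - r) / 2) ^ (N - k : ℕ)) * g (N - 2 * (k : ℕ)) =
      (∑ A : Finset (Fin N), (∏ k, (1 + signVector A k * r)) * g (∑ k, signVector A k)) /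
        2 ^ N := by
  simp only [prod_one_add_signVector_mul, sum_signVector, Fintype.card_fin]
  have h := Finset.sum_powerset_apply_card (x := (Finset.univ : Finset (Fin N)))
    (fun m => (1 - r) ^ m * (1 + r) ^ (N - m) * g (N - 2 * (m : ℕ)))
  rw [Finset.powerset_univ] at h
  rw [h, Finset.card_fin, ← Fin.sum_univ_eq_sum_range
    (fun m => N.choose m • ((1 - r) ^ m * (1 + r) ^ (N - m) * g (N - 2 * (m : ℕ)))),
    Finset.sum_div]
  refine Finset.sum_congr rfl fun k _ => ?_
  have hk : (2 : ℝ) ^ N = 2 ^ (k : ℕ) * 2 ^ (N - k : ℕ) := by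
    rw [← pow_add]; congr 1; omega
  rw [show 1 - (1 - r) / 2 = (1 + r) / 2 by ring, div_pow, div_pow, hk, nsmul_eq_mul]
  field_simp

/-- A function inducing a positive semidefinite kernel on the hypercube has a Bernstein polynomial
with nonnegative coefficients. -/
lemma exists_polynomial_eval_eq_bernstein (N : ℕ) (g : ℝ → ℝ)
    (hg : ∀ c : Finset (Fin N) → ℝ,
      0 ≤ ∑ A, ∑ B, c A * c B * g (∑ k, signVector A k * signVector B k))
    {T : ℝ} (hT : 0 ≤ T) :
    ∃ Q : ℝ[X], (∀ p, 0 ≤ Q.coeff p) ∧ ∀ r, Q.eval r =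
      ∑ k : Fin (N + 1), (N.choose k * ((1 - r / T) / 2) ^ (k : ℕ) *
        (1 - (1 - r / T) / 2) ^ (N - k : ℕ)) * g (N - 2 * (k : ℕ)) := by
  refine ⟨∑ S : Finset (Fin N), C ((∑ A : Finset (Fin N),
    (∏ k ∈ S, signVector A k) * g (∑ k, signVector A k)) / (T ^ #S * 2 ^ N)) * X ^ #S,
    fun p => ?_, fun r => ?_⟩
  · simp only [finsetSum_coeff, coeff_C_mul, coeff_X_pow]
    refine Finset.sum_nonneg fun S _ => mul_nonneg (div_nonneg (walsh_coeff_nonneg g hg S)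
      (by positivity)) (by split_ifs <;> norm_num)
  · rw [sum_bernstein_eq_sum_signVector, eval_finsetSum]
    simp only [eval_mul, eval_C, eval_pow, eval_X, Finset.prod_one_add, Finset.powerset_univ,
      Finset.sum_mul]
    rw [Finset.sum_comm, Finset.sum_div]
    refine Finset.sum_congr rfl fun S _ => ?_
    rw [div_mul_eq_mul_div, Finset.sum_mul, Finset.sum_div, Finset.sum_div]
    refine Finset.sum_congr rfl fun A _ => ?_
    rw [Finset.prod_mul_distrib, Finset.prod_const, div_pow]
    simp only [div_eq_mul_inv, mul_inv]
    ring

/-- A function inducing positive semidefinite kernels on all hypercubes is uniformly approximated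
on `[-T, T]` by polynomials with nonnegative coefficients. -/
lemma exists_nonneg_polynomial_near (ξ : ℝ → ℝ) (hcont : Continuous ξ) {T : ℝ} (hT : 0 < T)
    (hpsd : ∀ N : ℕ, 1 ≤ N → ∀ c : Finset (Fin N) → ℝ,
      0 ≤ ∑ A, ∑ B, c A * c B * ξ (T * (∑ k, signVector A k * signVector B k) / N))
    {δ : ℝ} (hδ : 0 < δ) :
    ∃ Q : ℝ[X], (∀ p, 0 ≤ Q.coeff p) ∧ ∀ x, |x| ≤ T → |Q.eval x - ξ x| < δ := by
  let f : C(unitInterval, ℝ) := ⟨fun y => ξ (T * (1 - 2 * y)), by fun_prop⟩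
  obtain ⟨N, hN, hN1⟩ := (((bernsteinApproximation_uniform f).eventually
    (Metric.ball_mem_nhds f hδ)).and (eventually_ge_atTop 1)).exists
  obtain ⟨Q, hQ, hev⟩ := exists_polynomial_eval_eq_bernstein N (fun s => ξ (T * s / N))
    (hpsd N hN1) hT.le
  refine ⟨Q, hQ, fun x hx => ?_⟩
  obtain ⟨h1, h2⟩ := abs_le.1 hx
  have h1' : -1 ≤ x / T := by rw [le_div_iff₀ hT]; linarith
  have h2' : x / T ≤ 1 := by rw [div_le_iff₀ hT]; linarith
  let y : unitInterval := ⟨(1 - x / T) / 2, by linarith, by linarith⟩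
  have hy := (ContinuousMap.dist_lt_iff hδ).1 (Metric.mem_ball.1 hN) y
  rw [Real.dist_eq] at hy
  have hfy : f y = ξ x := by
    change ξ (T * (1 - 2 * ((1 - x / T) / 2))) = ξ x
    congr 1
    field_simp
    ring
  have hb : bernsteinApproximation N f y = Q.eval x := by
    rw [hev, bernsteinApproximation.apply]
    refine Finset.sum_congr rfl fun k _ => ?_
    rw [bernstein_apply, smul_eq_mul]
    congr 1
    change ξ (T * (1 - 2 * ((k : ℕ) / N))) = _
    congr 1
    have : (N : ℝ) ≠ 0 := by positivity
    field_simp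
  rwa [hfy, hb] at hy

lemma hasSum_coeff_mul_pow (Q : ℝ[X]) (r : ℝ) :
    HasSum (fun p => Q.coeff p * r ^ p) (Q.eval r) := by
  rw [eval_eq_sum_range]
  refine hasSum_sum_of_ne_finset_zero fun p hp => ?_
  rw [coeff_eq_zero_of_natDegree_lt (by simpa using hp), zero_mul]

/-- A pointwise limit on `ℝ` of polynomials with nonnegative coefficients is an everywhere
convergent power series with nonnegative coefficients. -/
lemma exists_hasSum_of_tendsto_polynomial (ξ : ℝ → ℝ) (Q : ℕ → ℝ[X])
    (hQ : ∀ n p, 0 ≤ (Q n).coeff p)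
    (hlim : ∀ x, Tendsto (fun n => (Q n).eval x) atTop (𝓝 (ξ x))) :
    ∃ a : ℕ → ℝ, (∀ p, 0 ≤ a p) ∧ ∀ r : ℝ, HasSum (fun p : ℕ => a p * r ^ p) (ξ r) := by
  have bound (R : ℝ) (hR : 0 ≤ R) : ∃ M, ∀ n p, (Q n).coeff p * R ^ p ≤ M := by
    obtain ⟨M, hM⟩ := (hlim R).bddAbove_range
    refine ⟨M, fun n p => le_trans ?_ (hM ⟨n, rfl⟩)⟩
    exact le_hasSum (hasSum_coeff_mul_pow (Q n) R) p
      fun q _ => mul_nonneg (hQ n q) (pow_nonneg hR q)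
  obtain ⟨M₁, hM₁⟩ := bound 1 zero_le_one
  obtain ⟨a, ha, φ, hφ, hconv⟩ := (isCompact_univ_pi fun _ : ℕ =>
    isCompact_Icc (a := (0 : ℝ)) (b := M₁)).tendsto_subseq (x := fun n p => (Q n).coeff p)
    fun n p _ => ⟨hQ n p, by simpa using hM₁ n p⟩
  have ha0 (p : ℕ) : 0 ≤ a p := (ha p trivial).1
  have hcoeff (p : ℕ) : Tendsto (fun n => (Q (φ n)).coeff p) atTop (𝓝 (a p)) :=
    (tendsto_pi_nhds.1 hconv) p
  refine ⟨a, ha0, fun r => ?_⟩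
  have hR : 0 < |r| + 1 := by positivity
  obtain ⟨M, hM⟩ := bound (|r| + 1) hR.le
  have hsum : Summable fun p : ℕ => M * (|r| / (|r| + 1)) ^ p :=
    (summable_geometric_of_lt_one (by positivity)
      ((div_lt_one hR).2 (lt_add_one _))).mul_left M
  have hdom (n p : ℕ) : ‖(Q n).coeff p * r ^ p‖ ≤ M * (|r| / (|r| + 1)) ^ p := by
    rw [norm_mul, norm_pow, Real.norm_eq_abs, Real.norm_eq_abs, abs_of_nonneg (hQ n p), div_pow,
      mul_div_assoc', le_div_iff₀ (by positivity), mul_right_comm]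
    exact mul_le_mul_of_nonneg_right (hM n p) (by positivity)
  have hterm (p : ℕ) :
      Tendsto (fun n => (Q (φ n)).coeff p * r ^ p) atTop (𝓝 (a p * r ^ p)) :=
    (hcoeff p).mul_const _
  have ht := tendsto_tsum_of_dominated_convergence hsum hterm
    (Eventually.of_forall fun n p => hdom (φ n) p)
  simp only [(hasSum_coeff_mul_pow _ r).tsum_eq] at ht
  rw [← tendsto_nhds_unique ht ((hlim r).comp hφ.tendsto_atTop)]
  exact (Summable.of_norm_bounded hsum fun p =>
    le_of_tendsto (hterm p).norm (Eventually.of_forall fun n => hdom (φ n) p)).hasSum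

/-- If `ξ : ℝ → ℝ` is continuous and for every `N ≥ 1` the kernel
`(σ,τ) ↦ N ξ((σ·τ)/N)` on `ℝ^N` is positive semidefinite, then there exist nonnegative
reals `(a_p)_{p ≥ 0}` such that `ξ(r) = ∑_{p=0}^∞ a_p r^p` for every `r ∈ ℝ`: every
admissible covariance function of a spin-glass model with one type of spins is a power
series with nonnegative coefficients. -/
theorem nonneg_power_series_of_kernel_psd (ξ : ℝ → ℝ) (hcont : Continuous ξ)
    (hpsd : ∀ N : ℕ, 1 ≤ N → ∀ m : ℕ, 1 ≤ m →
      ∀ (σ : Fin m → Fin N → ℝ) (c : Fin m → ℝ),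
      0 ≤ ∑ i : Fin m, ∑ j : Fin m,
          c i * c j * ((N : ℝ) * ξ ((∑ k : Fin N, σ i k * σ j k) / N))) :
    ∃ a : ℕ → ℝ, (∀ p, 0 ≤ a p) ∧
      ∀ r : ℝ, HasSum (fun p : ℕ => a p * r ^ p) (ξ r) := by
  have hcube (T : ℝ) (hT : 0 ≤ T) (N : ℕ) (hN : 1 ≤ N) (c : Finset (Fin N) → ℝ) :
      0 ≤ ∑ A, ∑ B, c A * c B * ξ (T * (∑ k, signVector A k * signVector B k) / N) := by
    let e := Fintype.equivFin (Finset (Fin N))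
    have h := hpsd N hN (Fintype.card (Finset (Fin N))) Fintype.card_pos
      (fun i k => √T * signVector (e.symm i) k) (fun i => c (e.symm i))
    have hmul (A B : Finset (Fin N)) :
        ∑ k, √T * signVector A k * (√T * signVector B k) =
          T * ∑ k, signVector A k * signVector B k := by
      rw [Finset.mul_sum]
      refine Finset.sum_congr rfl fun k _ => ?_
      rw [mul_mul_mul_comm, Real.mul_self_sqrt hT]
    simp only [hmul] at h
    rw [e.symm.sum_comp fun A => ∑ j, c A * c (e.symm j) *
      (N * ξ ((T * ∑ k, signVector A k * signVector (e.symm j) k) / N))] at h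
    simp only [fun A => e.symm.sum_comp fun B => c A * c B *
      (N * ξ ((T * ∑ k, signVector A k * signVector B k) / N))] at h
    simp only [mul_left_comm _ (N : ℝ), ← Finset.mul_sum] at h
    exact (mul_nonneg_iff_of_pos_left (by positivity)).1 h
  choose Q hQ hnear using fun n : ℕ =>
    exists_nonneg_polynomial_near ξ hcont (T := n + 1) (by positivity)
      (hcube _ (by positivity)) (δ := 1 / (n + 1)) (by positivity)
  refine exists_hasSum_of_tendsto_polynomial ξ Q hQ fun x => ?_
  rw [tendsto_iff_dist_tendsto_zero]
  refine squeeze_zero' (Eventually.of_forall fun n => dist_nonneg) ?_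
    (tendsto_one_div_add_atTop_nhds_zero_nat (𝕜 := ℝ))
  filter_upwards [tendsto_natCast_atTop_atTop.eventually (eventually_ge_atTop |x|)] with n hn
  exact (hnear n x (by linarith)).le
end

section
/- (Equivalence of ensembles.) Let K ≥ 2, let e_1 < e_2 < … < e_K be real numbers, and let ē ∈ (e_1, e_K). Then: (i) there exists a unique β ∈ ℝ such that (Σ_{k=1}^K e_k exp(−β e_k)) / (Σ_{k=1}^K exp(−β e_k)) = ē; and (ii) for this β, if (ε_N)_{N≥1} are positive reals with ε_N → 0 and N ε_N → ∞, then the sets A_N = { x ∈ {e_1,…,e_K}^N : |N^{-1} Σ_{i=1}^N x_i − ē| ≤ ε_N } are nonempty for all sufficiently large N, and if X = (X_1,…,X_N) is sampled uniformly at random from A_N, then for every k ∈ {1,…,K}, the probability that X_1 = e_k converges as N → ∞ to exp(−β e_k) / Σ_{l=1}^K exp(−β e_l). In other words, the law of X_1 converges weakly to the Gibbs measure at inverse temperature β. -/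
open Filter
open scoped Classical

/-- The set of configurations `x ∈ {e_1, …, e_K}^N` (encoded by their indices in `Fin K`)
whose empirical mean `N^{-1} ∑_i x_i` is within `ε` of `ē`. -/
noncomputable def microcanonical (K N : ℕ) (e : Fin K → ℝ) (ebar ε : ℝ) :
    Finset (Fin N → Fin K) :=
  Finset.univ.filter fun x =>
    |(1 / (N : ℝ)) * ∑ i : Fin N, e (x i) - ebar| ≤ ε

section Root

variable {ι : Type*} [Fintype ι]

lemma strictAnti_sum_mul_exp (f : ι → ℝ) {a : ι} (ha : f a ≠ 0) :
    StrictAnti fun β : ℝ => ∑ k, f k * Real.exp (-β * f k) := by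
  intro x y hxy
  refine Finset.sum_lt_sum (fun k _ => ?_) ⟨a, Finset.mem_univ a, ?_⟩
  · rcases le_total (f k) 0 with h | h
    · exact mul_le_mul_of_nonpos_left (Real.exp_le_exp.2 (by nlinarith)) h
    · exact mul_le_mul_of_nonneg_left (Real.exp_le_exp.2 (by nlinarith)) h
  · rcases lt_or_gt_of_ne ha with h | h
    · exact mul_lt_mul_of_neg_left (Real.exp_lt_exp.2 (by nlinarith)) h
    · exact mul_lt_mul_of_pos_left (Real.exp_lt_exp.2 (by nlinarith)) h

lemma exists_sum_mul_exp_nonpos [DecidableEq ι] (f : ι → ℝ) {a : ι} (ha : f a < 0) :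
    ∃ β : ℝ, ∑ k, f k * Real.exp (-β * f k) ≤ 0 := by
  have hB : 0 ≤ ∑ k, |f k| := Finset.sum_nonneg fun k _ => abs_nonneg _
  have ha2 : 0 < f a ^ 2 := by nlinarith
  set β := (∑ k, |f k|) / f a ^ 2 with hβ
  have hβ0 : 0 ≤ β := by positivity
  have hβa : β * f a ^ 2 = ∑ k, |f k| := by rw [hβ, div_mul_cancel₀ _ ha2.ne']
  refine ⟨β, ?_⟩
  have hle : ∀ k, f k * Real.exp (-β * f k) ≤ |f k| := by
    intro k
    rcases le_total (f k) 0 with h | h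
    · exact (mul_nonpos_of_nonpos_of_nonneg h (Real.exp_pos _).le).trans (abs_nonneg _)
    · rw [abs_of_nonneg h]
      exact mul_le_of_le_one_right h (Real.exp_le_one_iff.2 (by nlinarith))
  have hla : f a * Real.exp (-β * f a) ≤ f a - β * f a ^ 2 := by
    have := Real.add_one_le_exp (-β * f a)
    nlinarith
  rw [← Finset.add_sum_erase _ _ (Finset.mem_univ a)]
  have h1 : ∑ k ∈ Finset.univ.erase a, f k * Real.exp (-β * f k)
      ≤ ∑ k ∈ Finset.univ.erase a, |f k| := Finset.sum_le_sum fun k _ => hle k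
  have h2 : ∑ k ∈ Finset.univ.erase a, |f k| ≤ ∑ k, |f k| :=
    Finset.sum_le_sum_of_subset_of_nonneg (Finset.erase_subset _ _) fun k _ _ => abs_nonneg _
  linarith

lemma existsUnique_sum_mul_exp_eq_zero [DecidableEq ι] (f : ι → ℝ) {a b : ι} (ha : f a < 0) (hb : 0 < f b) :
    ∃! β : ℝ, ∑ k, f k * Real.exp (-β * f k) = 0 := by
  have hanti := strictAnti_sum_mul_exp f ha.ne
  obtain ⟨x, hx⟩ := exists_sum_mul_exp_nonpos f ha
  obtain ⟨y, hy⟩ := exists_sum_mul_exp_nonpos (fun k => -f k) (a := b) (by simpa using hb)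
  have hy' : 0 ≤ ∑ k, f k * Real.exp (-(-y) * f k) := by
    simpa [Finset.sum_neg_distrib] using hy
  obtain ⟨β, hβ⟩ := mem_range_of_exists_le_of_exists_ge
    (f := fun β : ℝ => ∑ k, f k * Real.exp (-β * f k)) (c := 0) (by fun_prop) ⟨x, hx⟩ ⟨-y, hy'⟩
  exact ⟨β, hβ, fun z hz => hanti.injective (hz.trans hβ.symm)⟩

lemma gibbs_mean_eq_iff [Nonempty ι] (e : ι → ℝ) (ebar β : ℝ) :
    (∑ k, e k * Real.exp (-β * e k)) / (∑ k, Real.exp (-β * e k)) = ebar ↔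
      ∑ k, (e k - ebar) * Real.exp (-β * (e k - ebar)) = 0 := by
  have hZ : 0 < ∑ k, Real.exp (-β * e k) :=
    Finset.sum_pos (fun k _ => Real.exp_pos _) Finset.univ_nonempty
  have hshift : ∑ k, (e k - ebar) * Real.exp (-β * (e k - ebar)) =
      Real.exp (β * ebar) *
        (∑ k, e k * Real.exp (-β * e k) - ebar * ∑ k, Real.exp (-β * e k)) := by
    rw [Finset.mul_sum, ← Finset.sum_sub_distrib, Finset.mul_sum]
    refine Finset.sum_congr rfl fun k _ => ?_
    rw [show -β * (e k - ebar) = β * ebar + -β * e k by ring, Real.exp_add]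
    ring
  rw [hshift, div_eq_iff hZ.ne', mul_eq_zero, or_iff_right (Real.exp_pos _).ne', sub_eq_zero]

end Root

section ProductWeights

variable {ι : Type*} [Fintype ι] {p h : ι → ℝ}

lemma sum_prod_eq_one (h1 : ∑ k, p k = 1) (N : ℕ) :
    ∑ x : Fin N → ι, ∏ i, p (x i) = 1 := by
  rw [← Fintype.sum_pow, h1, one_pow]

lemma exists_mgf_lt_one (h1 : ∑ k, p k = 1) (hm : ∑ k, p k * h k < 0) :
    ∃ t : ℝ, 0 < t ∧ ∑ k, p k * Real.exp (t * h k) < 1 := by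
  have hd : HasDerivAt (fun t : ℝ => ∑ k, p k * Real.exp (t * h k)) (∑ k, p k * h k) 0 := by
    refine HasDerivAt.fun_sum fun k _ => ?_
    have := (((hasDerivAt_id (0 : ℝ)).mul_const (h k)).exp).const_mul (p k)
    simpa using this
  have hs := (hasDerivAt_iff_tendsto_slope.1 hd).mono_left
    (nhdsWithin_mono (0 : ℝ) (fun x (hx : 0 < x) => hx.ne') :
      nhdsWithin (0 : ℝ) (Set.Ioi 0) ≤ nhdsWithin 0 {0}ᶜ)
  obtain ⟨t, hlt, ht⟩ := ((hs.eventually_lt_const hm).and self_mem_nhdsWithin).exists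
  have ht : 0 < t := ht
  refine ⟨t, ht, ?_⟩
  rw [slope_def_field] at hlt
  simp only [zero_mul, Real.exp_zero, mul_one, h1, sub_zero] at hlt
  rw [div_neg_iff] at hlt
  rcases hlt with h' | h' <;> linarith [h'.1, h'.2]

lemma exists_chernoff_bound [Nonempty ι] (hp : ∀ k, 0 < p k) (h1 : ∑ k, p k = 1)
    (hm : ∑ k, p k * h k < 0) :
    ∃ ρ : ℝ, 0 < ρ ∧ ρ < 1 ∧ ∀ N : ℕ,
      ∑ x : Fin N → ι with 0 ≤ ∑ i, h (x i), ∏ i, p (x i) ≤ ρ ^ N := by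
  obtain ⟨t, ht, hlt⟩ := exists_mgf_lt_one h1 hm
  refine ⟨_, Finset.sum_pos (fun k _ => mul_pos (hp k) (Real.exp_pos _)) Finset.univ_nonempty,
    hlt, fun N => ?_⟩
  rw [Fintype.sum_pow]
  calc ∑ x : Fin N → ι with 0 ≤ ∑ i, h (x i), ∏ i, p (x i)
      ≤ ∑ x : Fin N → ι with 0 ≤ ∑ i, h (x i), ∏ i, p (x i) * Real.exp (t * h (x i)) := by
        refine Finset.sum_le_sum fun x hx => ?_
        rw [Finset.prod_mul_distrib, ← Real.exp_sum, ← Finset.mul_sum]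
        refine le_mul_of_one_le_right (Finset.prod_nonneg fun i _ => (hp _).le) ?_
        exact Real.one_le_exp (mul_nonneg ht.le (Finset.mem_filter.1 hx).2)
    _ ≤ _ := Finset.sum_le_sum_of_subset_of_nonneg (Finset.filter_subset _ _)
        fun x _ _ => Finset.prod_nonneg fun i _ => mul_nonneg (hp _).le (Real.exp_pos _).le

/-- Exponential form of the weak law of large numbers for a centred observable. -/
lemma exists_deviation_bound [DecidableEq ι] [Nonempty ι] (hp : ∀ k, 0 < p k) (h1 : ∑ k, p k = 1)
    (hm : ∑ k, p k * h k = 0) {η : ℝ} (hη : 0 < η) :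
    ∃ ρ : ℝ, 0 < ρ ∧ ρ < 1 ∧ ∀ N : ℕ,
      ∑ x : Fin N → ι with η * N ≤ |∑ i, h (x i)|, ∏ i, p (x i) ≤ 2 * ρ ^ N := by
  obtain ⟨ρ₁, h10, h11, hb1⟩ := exists_chernoff_bound (h := fun k => h k - η) hp h1 (by
    simp only [mul_sub, Finset.sum_sub_distrib, ← Finset.sum_mul, hm, h1]; linarith)
  obtain ⟨ρ₂, h20, h21, hb2⟩ := exists_chernoff_bound (h := fun k => -h k - η) hp h1 (by
    simp only [mul_sub, mul_neg, Finset.sum_sub_distrib, Finset.sum_neg_distrib, ← Finset.sum_mul,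
      hm, h1]; linarith)
  refine ⟨max ρ₁ ρ₂, lt_max_of_lt_left h10, max_lt h11 h21, fun N => ?_⟩
  have hsub : (Finset.univ.filter fun x : Fin N → ι => η * N ≤ |∑ i, h (x i)|) ⊆
      (Finset.univ.filter fun x : Fin N → ι => 0 ≤ ∑ i, (h (x i) - η)) ∪
      (Finset.univ.filter fun x : Fin N → ι => 0 ≤ ∑ i, (-h (x i) - η)) := by
    intro x hx
    simp only [Finset.mem_filter, Finset.mem_union, Finset.mem_univ, true_and,
      Finset.sum_sub_distrib, Finset.sum_neg_distrib, Finset.sum_const, Finset.card_univ,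
      Fintype.card_fin, nsmul_eq_mul] at hx ⊢
    rcases le_abs.1 hx with h' | h'
    · left; linarith
    · right; linarith
  have hnn : ∀ x : Fin N → ι, 0 ≤ ∏ i, p (x i) := fun x => Finset.prod_nonneg fun i _ => (hp _).le
  calc _ ≤ _ := Finset.sum_le_sum_of_subset_of_nonneg hsub fun x _ _ => hnn x
    _ ≤ _ := by
        rw [← Finset.sum_union_inter]
        exact le_add_of_nonneg_right (Finset.sum_nonneg fun x _ => hnn x)
    _ ≤ ρ₁ ^ N + ρ₂ ^ N := add_le_add (hb1 N) (hb2 N)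
    _ ≤ _ := by
      have a1 := pow_le_pow_left₀ h10.le (le_max_left ρ₁ ρ₂) N
      have a2 := pow_le_pow_left₀ h20.le (le_max_right ρ₁ ρ₂) N
      linarith

end ProductWeights

section LowerBound

variable {ι : Type*} [Fintype ι] {p f : ι → ℝ}

/-- Prepending one well-chosen coordinate narrows the window of allowed sums by `c`. -/
lemma mul_windowWeight_le_succ [DecidableEq ι] (hp : ∀ k, 0 < p k) {a b : ι} {c C q R : ℝ}
    (hfa : f a ≤ -c) (hfb : c ≤ f b) (hCa : -C ≤ f a) (hCb : f b ≤ C) (hqa : q ≤ p a)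
    (hqb : q ≤ p b) (hR : C ≤ R) (N : ℕ) :
    q * ∑ x : Fin N → ι with |∑ i, f (x i)| ≤ R + c, ∏ i, p (x i) ≤
      ∑ x : Fin (N + 1) → ι with |∑ i, f (x i)| ≤ R, ∏ i, p (x i) := by
  let φ : (Fin N → ι) → (Fin (N + 1) → ι) := fun x =>
    Fin.cons (if 0 ≤ ∑ i, f (x i) then a else b) x
  have hφ : Function.Injective φ := fun x y hxy => (Fin.cons_injective2 hxy).2
  have hnn : ∀ (M : ℕ) (x : Fin M → ι), 0 ≤ ∏ i, p (x i) :=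
    fun M x => Finset.prod_nonneg fun i _ => (hp _).le
  rw [Finset.mul_sum]
  calc ∑ x : Fin N → ι with |∑ i, f (x i)| ≤ R + c, q * ∏ i, p (x i)
      ≤ ∑ x : Fin N → ι with |∑ i, f (x i)| ≤ R + c, ∏ i, p (φ x i) := by
        refine Finset.sum_le_sum fun x _ => ?_
        simp only [φ, Fin.prod_univ_succ, Fin.cons_zero, Fin.cons_succ]
        refine mul_le_mul_of_nonneg_right ?_ (hnn N x)
        split_ifs <;> assumption
    _ = ∑ y ∈ (Finset.univ.filter fun x : Fin N → ι => |∑ i, f (x i)| ≤ R + c).image φ,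
          ∏ i, p (y i) := by
        rw [Finset.sum_image hφ.injOn]
    _ ≤ _ := by
        refine Finset.sum_le_sum_of_subset_of_nonneg (fun y hy => ?_) fun x _ _ => hnn _ x
        obtain ⟨x, hx, rfl⟩ := Finset.mem_image.1 hy
        have hx := abs_le.1 (Finset.mem_filter.1 hx).2
        simp only [Finset.mem_filter, Finset.mem_univ, true_and, φ, Fin.sum_univ_succ,
          Fin.cons_zero, Fin.cons_succ, abs_le]
        split_ifs <;> constructor <;> linarith [hx.1, hx.2]

lemma pow_mul_windowWeight_le_add [DecidableEq ι] (hp : ∀ k, 0 < p k) {a b : ι} {c C q : ℝ}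
    (hc : 0 ≤ c) (hq : 0 ≤ q)
    (hfa : f a ≤ -c) (hfb : c ≤ f b) (hCa : -C ≤ f a) (hCb : f b ≤ C) (hqa : q ≤ p a)
    (hqb : q ≤ p b) (m L : ℕ) {R : ℝ} (hR : C ≤ R) :
    q ^ L * ∑ x : Fin m → ι with |∑ i, f (x i)| ≤ R + L * c, ∏ i, p (x i) ≤
      ∑ x : Fin (m + L) → ι with |∑ i, f (x i)| ≤ R, ∏ i, p (x i) := by
  induction L generalizing R with
  | zero => simp
  | succ L ih =>
    have h1 := ih (R := R + c) (by linarith)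
    have h2 := mul_windowWeight_le_succ hp hfa hfb hCa hCb hqa hqb hR (m + L)
    have h3 : R + ((L + 1 : ℕ) : ℝ) * c = R + c + L * c := by push_cast; ring
    rw [h3, pow_succ', mul_assoc]
    exact (mul_le_mul_of_nonneg_left h1 hq).trans h2

/-- A window of fixed width around the mean has subexponentially small probability at worst. -/
lemma eventually_pow_le_windowWeight [DecidableEq ι] (hp : ∀ k, 0 < p k) (h1 : ∑ k, p k = 1)
    (hm : ∑ k, p k * f k = 0) {a b : ι} (ha : f a < 0) (hb : 0 < f b) {r : ℝ} (hr0 : 0 < r)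
    (hr1 : r < 1) :
    ∀ᶠ N : ℕ in atTop,
      r ^ N ≤ ∑ x : Fin N → ι with |∑ i, f (x i)| ≤ max (-f a) (f b), ∏ i, p (x i) := by
  have : Nonempty ι := ⟨a⟩
  set c := min (-f a) (f b) with hc
  set C := max (-f a) (f b) with hC
  set q := min (p a) (p b) with hq
  have hc0 : 0 < c := lt_min (by linarith) hb
  have hq0 : 0 < q := lt_min (hp a) (hp b)
  obtain ⟨j, hj⟩ := exists_pow_lt_of_lt_one (half_pos hq0) hr1
  set J := j + 2 with hJ
  have hJr : r ^ J ≤ q / 2 := (pow_le_pow_of_le_one hr0.le hr1.le (by omega)).trans hj.le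
  have hJ0 : (0 : ℝ) < J := by positivity
  obtain ⟨ρ, hρ0, hρ1, hρ⟩ := exists_deviation_bound hp h1 hm (η := c / (2 * J)) (by positivity)
  obtain ⟨M, hM⟩ := exists_pow_lt_of_lt_one (show (0 : ℝ) < 1 / 4 by norm_num) hρ1
  filter_upwards [eventually_ge_atTop (max J (2 * M))] with N hN
  have hNJ : J ≤ N := (le_max_left _ _).trans hN
  have hNM : 2 * M ≤ N := (le_max_right _ _).trans hN
  obtain ⟨L, m, hL1, hLN, hNL, hmL⟩ : ∃ L m : ℕ, 1 ≤ L ∧ J * L ≤ N ∧ N < J * (L + 1) ∧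
      N = m + L := by
    refine ⟨N / J, N - N / J, ?_, Nat.mul_div_le _ _, ?_, ?_⟩
    · exact (Nat.one_le_div_iff (by omega)).2 hNJ
    · exact Nat.lt_mul_div_succ _ (by omega)
    · have := Nat.div_le_self N J
      omega
  have h2L : 2 * L ≤ N := (Nat.mul_le_mul_right L (by omega : 2 ≤ J)).trans hLN
  have hhalf : 1 / 2 ≤ ∑ x : Fin m → ι with |∑ i, f (x i)| ≤ C + L * c, ∏ i, p (x i) := by
    have hρm : ρ ^ m ≤ 1 / 4 := (pow_le_pow_of_le_one hρ0.le hρ1.le (by omega)).trans hM.le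
    have hsplit := Finset.sum_filter_add_sum_filter_not (Finset.univ : Finset (Fin m → ι))
      (fun x => |∑ i, f (x i)| ≤ C + L * c) (fun x => ∏ i, p (x i))
    rw [sum_prod_eq_one h1] at hsplit
    have hwin : c / (2 * J) * m ≤ C + L * c := by
      have hC0 : 0 ≤ C := hb.le.trans (le_max_right _ _)
      have : (m : ℝ) ≤ J * (2 * L) := by
        have : m ≤ J * (2 * L) := by
          have := Nat.mul_le_mul_left J (by omega : L + 1 ≤ 2 * L)
          omega
        exact_mod_cast this
      have : c / (2 * J) * m ≤ c / (2 * J) * (J * (2 * L)) := by gcongr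
      have e1 : c / (2 * J) * (J * (2 * L)) = L * c := by field_simp
      linarith
    have hbad : ∑ x : Fin m → ι with ¬ |∑ i, f (x i)| ≤ C + L * c, ∏ i, p (x i) ≤ 2 * ρ ^ m := by
      refine (Finset.sum_le_sum_of_subset_of_nonneg (fun x hx => ?_)
        fun x _ _ => Finset.prod_nonneg fun i _ => (hp _).le).trans (hρ m)
      simp only [Finset.mem_filter, Finset.mem_univ, true_and, not_le] at hx ⊢
      linarith
    linarith
  have hstep := pow_mul_windowWeight_le_add hp hc0.le hq0.le (a := a) (b := b) (C := C)
    (by linarith [min_le_left (-f a) (f b)]) (min_le_right _ _)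
    (by linarith [le_max_left (-f a) (f b)]) (le_max_right _ _) (min_le_left _ _)
    (min_le_right _ _) m L le_rfl
  have hpow : r ^ N ≤ q ^ L * (1 / 2) := calc
    r ^ N ≤ r ^ (J * L) := pow_le_pow_of_le_one hr0.le hr1.le hLN
    _ = (r ^ J) ^ L := pow_mul _ _ _
    _ ≤ (q / 2) ^ L := by gcongr
    _ = q ^ L * (1 / 2) ^ L := by rw [← mul_pow]; ring
    _ ≤ q ^ L * (1 / 2) := by
      gcongr
      exact pow_le_of_le_one (by norm_num) (by norm_num) (by omega)
  subst hmL
  exact hpow.trans ((mul_le_mul_of_nonneg_left hhalf (by positivity)).trans hstep)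

end LowerBound

section Exchangeability

variable {ι : Type*} [Fintype ι] [DecidableEq ι]

lemma succ_mul_card_filter_zero (f : ι → ℝ) (W : ℝ) (N : ℕ) (k : ι) :
    ((N : ℝ) + 1) * (((Finset.univ.filter fun x : Fin (N + 1) → ι =>
        |∑ i, f (x i)| ≤ W).filter fun x => x 0 = k).card : ℝ) =
      ∑ x : Fin (N + 1) → ι with |∑ i, f (x i)| ≤ W,
        ∑ i, if x i = k then (1 : ℝ) else 0 := by
  rw [Finset.sum_comm]
  have hi : ∀ i : Fin (N + 1), (∑ x : Fin (N + 1) → ι with |∑ i, f (x i)| ≤ W,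
      if x i = k then (1 : ℝ) else 0) = (((Finset.univ.filter fun x : Fin (N + 1) → ι =>
        |∑ i, f (x i)| ≤ W).filter fun x => x 0 = k).card : ℝ) := by
    intro i
    rw [Finset.sum_boole]
    congr 1
    refine Finset.card_equiv ((Equiv.swap 0 i).arrowCongr (Equiv.refl ι)) fun x => ?_
    have hs : ∑ l, f (x (Equiv.swap 0 i l)) = ∑ l, f (x l) :=
      Equiv.sum_comp (Equiv.swap 0 i) fun l => f (x l)
    simp [Equiv.arrowCongr_apply, hs]
  simp only [hi, Finset.sum_const, Finset.card_univ, Fintype.card_fin, nsmul_eq_mul]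
  push_cast
  ring

lemma abs_marginal_sub_le (f : ι → ℝ) (W : ℝ) (N : ℕ) (k : ι) {v η : ℝ} (hv0 : 0 ≤ v)
    (hv1 : v ≤ 1) (hη : 0 ≤ η)
    (hA : 0 < (Finset.univ.filter fun x : Fin (N + 1) → ι => |∑ i, f (x i)| ≤ W).card) :
    |(((Finset.univ.filter fun x : Fin (N + 1) → ι =>
        |∑ i, f (x i)| ≤ W).filter fun x => x 0 = k).card : ℝ) /
      (Finset.univ.filter fun x : Fin (N + 1) → ι => |∑ i, f (x i)| ≤ W).card - v| ≤
    η + (((Finset.univ.filter fun x : Fin (N + 1) → ι => |∑ i, f (x i)| ≤ W).filter fun x =>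
        η * (N + 1 : ℕ) ≤ |∑ i, ((if x i = k then (1 : ℝ) else 0) - v)|).card : ℝ) /
      (Finset.univ.filter fun x : Fin (N + 1) → ι => |∑ i, f (x i)| ≤ W).card := by
  have hex := succ_mul_card_filter_zero f W N k
  set A := Finset.univ.filter fun x : Fin (N + 1) → ι => |∑ i, f (x i)| ≤ W
  have hA' : (0 : ℝ) < A.card := by exact_mod_cast hA
  have hN : (0 : ℝ) < (N : ℝ) + 1 := by positivity
  set H : (Fin (N + 1) → ι) → ℝ := fun x => ∑ i, ((if x i = k then (1 : ℝ) else 0) - v) with hH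
  have hsum : ((N : ℝ) + 1) * (((A.filter fun x => x 0 = k).card : ℝ) - v * A.card) =
      ∑ x ∈ A, H x := by
    rw [mul_sub, hex]
    simp only [hH, Finset.sum_sub_distrib, Finset.sum_const, Finset.card_univ, Fintype.card_fin,
      nsmul_eq_mul]
    push_cast
    ring
  have hHle : ∀ x, |H x| ≤ (N : ℝ) + 1 := by
    intro x
    calc |H x| ≤ ∑ i, |(if x i = k then (1 : ℝ) else 0) - v| := Finset.abs_sum_le_sum_abs _ _
      _ ≤ ∑ i : Fin (N + 1), (1 : ℝ) := by
        refine Finset.sum_le_sum fun i _ => abs_le.2 ?_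
        split_ifs <;> constructor <;> linarith
      _ = _ := by simp
  have hbound : |∑ x ∈ A, H x| ≤ ((N : ℝ) + 1) * (η * A.card +
      ((A.filter fun x => η * (N + 1 : ℕ) ≤ |H x|).card : ℝ)) := by
    calc |∑ x ∈ A, H x| ≤ ∑ x ∈ A, |H x| := Finset.abs_sum_le_sum_abs _ _
      _ ≤ ∑ x ∈ A, ((N : ℝ) + 1) * (η + if η * (N + 1 : ℕ) ≤ |H x| then (1 : ℝ) else 0) := by
        refine Finset.sum_le_sum fun x _ => ?_
        have := hHle x
        split_ifs with hx
        · nlinarith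
        · push_cast at hx
          linarith
      _ = _ := by
        rw [← Finset.mul_sum, Finset.sum_add_distrib, Finset.sum_boole]
        simp [mul_comm]
  rw [← hsum, abs_mul, abs_of_pos hN] at hbound
  have hb := le_of_mul_le_mul_left hbound hN
  have e1 : ((A.filter fun x => x 0 = k).card : ℝ) / A.card - v =
      (((A.filter fun x => x 0 = k).card : ℝ) - v * A.card) / A.card := by field_simp
  rw [e1, abs_div, abs_of_pos hA', div_le_iff₀ hA', add_mul, div_mul_cancel₀ _ hA'.ne']
  exact hb

end Exchangeability

section TiltedWindow

variable {ι : Type*} {p f : ι → ℝ}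

/-- On a window `|∑ f| ≤ W`, exponentially tilted weights are constant up to `exp (|β| W)`. -/
lemma prod_tilted_bounds {c β W : ℝ} (hc : 0 < c) (hpf : ∀ k, p k = c * Real.exp (-β * f k))
    {N : ℕ} {x : Fin N → ι} (hx : |∑ i, f (x i)| ≤ W) :
    c ^ N * Real.exp (-(|β| * W)) ≤ ∏ i, p (x i) ∧
      ∏ i, p (x i) ≤ c ^ N * Real.exp (|β| * W) := by
  have hprod : ∏ i, p (x i) = c ^ N * Real.exp (-β * ∑ i, f (x i)) := by
    simp only [hpf, Finset.prod_mul_distrib, Finset.prod_const, Finset.card_univ, Fintype.card_fin,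
      ← Real.exp_sum, ← Finset.mul_sum]
  have habs : |-β * ∑ i, f (x i)| ≤ |β| * W := by
    rw [abs_mul, abs_neg]
    exact mul_le_mul_of_nonneg_left hx (abs_nonneg _)
  have := abs_le.1 habs
  rw [hprod]
  constructor <;> refine mul_le_mul_of_nonneg_left (Real.exp_le_exp.2 ?_) (by positivity)
  · exact this.1
  · exact this.2

variable [Fintype ι]

/-- Comparison of the uniform measure on a window with the tilted product measure. -/
lemma card_filter_mul_le {c β W : ℝ} (hc : 0 < c) (hpf : ∀ k, p k = c * Real.exp (-β * f k))
    {N : ℕ} (P : (Fin N → ι) → Prop) [DecidablePred P] :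
    (((Finset.univ.filter fun x : Fin N → ι => |∑ i, f (x i)| ≤ W).filter P).card : ℝ) *
        ∑ x : Fin N → ι with |∑ i, f (x i)| ≤ W, ∏ i, p (x i) ≤
      Real.exp (2 * (|β| * W)) *
        (Finset.univ.filter fun x : Fin N → ι => |∑ i, f (x i)| ≤ W).card *
        ∑ x : Fin N → ι with P x, ∏ i, p (x i) := by
  have hp : ∀ k, 0 < p k := fun k => by rw [hpf]; positivity
  set A := Finset.univ.filter fun x : Fin N → ι => |∑ i, f (x i)| ≤ W
  have hup : ∑ x ∈ A, ∏ i, p (x i) ≤ A.card * (c ^ N * Real.exp (|β| * W)) := by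
    rw [← nsmul_eq_mul]
    exact Finset.sum_le_card_nsmul _ _ _ fun x hx =>
      (prod_tilted_bounds hc hpf (Finset.mem_filter.1 hx).2).2
  have hlo : ((A.filter P).card : ℝ) * (c ^ N * Real.exp (-(|β| * W))) ≤
      ∑ x : Fin N → ι with P x, ∏ i, p (x i) := by
    rw [← nsmul_eq_mul]
    refine (Finset.card_nsmul_le_sum _ _ _ fun x hx => (prod_tilted_bounds hc hpf
      (Finset.mem_filter.1 (Finset.mem_filter.1 hx).1).2).1).trans ?_
    exact Finset.sum_le_sum_of_subset_of_nonneg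
      (Finset.filter_subset_filter _ (Finset.subset_univ _))
      fun x _ _ => Finset.prod_nonneg fun i _ => (hp _).le
  have hexp : Real.exp (|β| * W) = Real.exp (2 * (|β| * W)) * Real.exp (-(|β| * W)) := by
    rw [← Real.exp_add]; ring_nf
  calc _ ≤ ((A.filter P).card : ℝ) * (A.card * (c ^ N * Real.exp (|β| * W))) := by gcongr
    _ = Real.exp (2 * (|β| * W)) * A.card *
        (((A.filter P).card : ℝ) * (c ^ N * Real.exp (-(|β| * W)))) := by rw [hexp]; ring
    _ ≤ _ := by gcongr

variable [DecidableEq ι]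

lemma eventually_window_nonempty (hp : ∀ k, 0 < p k) (h1 : ∑ k, p k = 1)
    (hm : ∑ k, p k * f k = 0) {a b : ι} (ha : f a < 0) (hb : 0 < f b) {W : ℕ → ℝ}
    (hW : Tendsto W atTop atTop) :
    ∀ᶠ N : ℕ in atTop,
      (Finset.univ.filter fun x : Fin N → ι => |∑ i, f (x i)| ≤ W N).Nonempty := by
  filter_upwards [eventually_pow_le_windowWeight hp h1 hm ha hb (r := 1 / 2) (by norm_num)
    (by norm_num), hW.eventually_ge_atTop (max (-f a) (f b))] with N hN hWN
  obtain ⟨x, hx, -⟩ := Finset.exists_ne_zero_of_sum_ne_zero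
    ((pow_pos (by norm_num : (0 : ℝ) < 1 / 2) N).trans_le hN).ne'
  exact ⟨x, Finset.mem_filter.2 ⟨Finset.mem_univ _, (Finset.mem_filter.1 hx).2.trans hWN⟩⟩

/-- Under the uniform measure on a window of width `N ε_N`, events of exponentially small
tilted probability are negligible. -/
lemma tendsto_card_filter_div_zero {c β : ℝ} (hc : 0 < c)
    (hpf : ∀ k, p k = c * Real.exp (-β * f k)) (h1 : ∑ k, p k = 1)
    (hm : ∑ k, p k * f k = 0) {a b : ι} (ha : f a < 0) (hb : 0 < f b) {ε : ℕ → ℝ}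
    (hε : Tendsto ε atTop (nhds 0)) (hW : Tendsto (fun N : ℕ => (N : ℝ) * ε N) atTop atTop)
    (P : ∀ N, (Fin N → ι) → Prop) [∀ N, DecidablePred (P N)] {ρ : ℝ} (hρ0 : 0 < ρ) (hρ1 : ρ < 1)
    (hP : ∀ N, ∑ x : Fin N → ι with P N x, ∏ i, p (x i) ≤ 2 * ρ ^ N) :
    Tendsto (fun N : ℕ =>
      (((Finset.univ.filter fun x : Fin N → ι => |∑ i, f (x i)| ≤ N * ε N).filter (P N)).card : ℝ) /
        (Finset.univ.filter fun x : Fin N → ι => |∑ i, f (x i)| ≤ N * ε N).card)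
      atTop (nhds 0) := by
  have hp : ∀ k, 0 < p k := fun k => by rw [hpf]; positivity
  obtain ⟨r, hρr, hr1⟩ := exists_between hρ1
  have hr0 : 0 < r := hρ0.trans hρr
  obtain ⟨s, hs, hs1⟩ := exists_between ((div_lt_one hr0).2 hρr)
  have hs0 : 0 < s := (div_pos hρ0 hr0).trans hs
  have hlim : Tendsto (fun N => Real.exp (2 * (|β| * ε N)) * (ρ / r)) atTop (nhds (ρ / r)) := by
    have := ((Real.continuous_exp.tendsto _).comp
      ((hε.const_mul |β|).const_mul 2)).mul_const (ρ / r)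
    simpa using this
  have hgeo : Tendsto (fun N : ℕ => 2 * s ^ N) atTop (nhds 0) := by
    simpa using (tendsto_pow_atTop_nhds_zero_of_lt_one hs0.le hs1).const_mul 2
  refine squeeze_zero' (Eventually.of_forall fun N => by positivity) ?_ hgeo
  filter_upwards [hlim.eventually_le_const hs, eventually_pow_le_windowWeight hp h1 hm ha hb hr0 hr1,
    hW.eventually_ge_atTop (max (-f a) (f b)), eventually_window_nonempty hp h1 hm ha hb hW]
    with N hsN hrN hWN hne
  have hcomp := card_filter_mul_le (W := N * ε N) hc hpf (P N)
  have hmono : r ^ N ≤ ∑ x : Fin N → ι with |∑ i, f (x i)| ≤ N * ε N, ∏ i, p (x i) :=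
    hrN.trans (Finset.sum_le_sum_of_subset_of_nonneg
      (Finset.monotone_filter_right _ fun x _ hx => hx.trans hWN)
      fun x _ _ => Finset.prod_nonneg fun i _ => (hp _).le)
  have hA : (0 : ℝ) < (Finset.univ.filter fun x : Fin N → ι => |∑ i, f (x i)| ≤ N * ε N).card := by
    exact_mod_cast hne.card_pos
  set A := Finset.univ.filter fun x : Fin N → ι => |∑ i, f (x i)| ≤ N * ε N
  rw [div_le_iff₀ hA]
  have hrpos : 0 < r ^ N := pow_pos hr0 N
  refine le_of_mul_le_mul_right ?_ hrpos
  have hexp : Real.exp (2 * (|β| * (N * ε N))) = Real.exp (2 * (|β| * ε N)) ^ N := by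
    rw [← Real.exp_nat_mul]; ring_nf
  calc ((A.filter (P N)).card : ℝ) * r ^ N
      ≤ (A.filter (P N)).card * ∑ x ∈ A, ∏ i, p (x i) := by gcongr
    _ ≤ _ := hcomp
    _ ≤ Real.exp (2 * (|β| * (N * ε N))) * A.card * (2 * ρ ^ N) := by gcongr; exact hP N
    _ = 2 * (Real.exp (2 * (|β| * ε N)) * (ρ / r)) ^ N * A.card * r ^ N := by
      rw [hexp, mul_pow, div_pow]
      field_simp
    _ ≤ 2 * s ^ N * A.card * r ^ N := by gcongr

lemma tendsto_marginal {c β : ℝ} (hc : 0 < c)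
    (hpf : ∀ k, p k = c * Real.exp (-β * f k)) (h1 : ∑ k, p k = 1)
    (hm : ∑ k, p k * f k = 0) {a b : ι} (ha : f a < 0) (hb : 0 < f b) {ε : ℕ → ℝ}
    (hε : Tendsto ε atTop (nhds 0)) (hW : Tendsto (fun N : ℕ => (N : ℝ) * ε N) atTop atTop)
    (k : ι) :
    Tendsto (fun N : ℕ =>
      (((Finset.univ.filter fun x : Fin (N + 1) → ι =>
        |∑ i, f (x i)| ≤ (N + 1 : ℕ) * ε (N + 1)).filter fun x => x 0 = k).card : ℝ) /
        (Finset.univ.filter fun x : Fin (N + 1) → ι =>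
          |∑ i, f (x i)| ≤ (N + 1 : ℕ) * ε (N + 1)).card)
      atTop (nhds (p k)) := by
  have : Nonempty ι := ⟨a⟩
  have hp : ∀ k, 0 < p k := fun k => by rw [hpf]; positivity
  have hp1 : p k ≤ 1 := h1 ▸ Finset.single_le_sum (fun i _ => (hp i).le) (Finset.mem_univ k)
  have hcent : ∑ l, p l * ((if l = k then (1 : ℝ) else 0) - p k) = 0 := by
    simp [mul_sub, Finset.sum_sub_distrib, ← Finset.sum_mul, h1]
  rw [Metric.tendsto_nhds]
  intro δ hδ
  obtain ⟨ρ, hρ0, hρ1, hρ⟩ := exists_deviation_bound hp h1 hcent (half_pos hδ)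
  have hz := tendsto_card_filter_div_zero hc hpf h1 hm ha hb hε hW
    (fun N x => δ / 2 * N ≤ |∑ i, ((if x i = k then (1 : ℝ) else 0) - p k)|) hρ0 hρ1 hρ
  filter_upwards [(tendsto_add_atTop_iff_nat 1).2 hz |>.eventually_lt_const (half_pos hδ),
    (tendsto_add_atTop_nat 1).eventually (eventually_window_nonempty hp h1 hm ha hb hW)]
    with N hN hne
  have := abs_marginal_sub_le f ((N + 1 : ℕ) * ε (N + 1)) N k (hp k).le hp1 (half_pos hδ).le
    hne.card_pos
  rw [Real.dist_eq]
  linarith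

end TiltedWindow

lemma microcanonical_eq_filter (K N : ℕ) (hN : 0 < N) (e : Fin K → ℝ) (ebar ε : ℝ) :
    microcanonical K N e ebar ε =
      Finset.univ.filter fun x : Fin N → Fin K => |∑ i, (e (x i) - ebar)| ≤ N * ε := by
  have hN' : (0 : ℝ) < N := by exact_mod_cast hN
  refine Finset.filter_congr fun x _ => ?_
  have : ∑ i, (e (x i) - ebar) = N * (1 / (N : ℝ) * ∑ i, e (x i) - ebar) := by
    simp only [Finset.sum_sub_distrib, Finset.sum_const, Finset.card_univ, Fintype.card_fin,
      nsmul_eq_mul]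
    field_simp
  rw [this, abs_mul, abs_of_pos hN', mul_le_mul_iff_right₀ hN']

/-- Equivalence of ensembles. Let `e_1 < … < e_K` be real numbers (`K ≥ 2`) and let
`ē ∈ (e_1, e_K)`. Then: (i) there is a unique `β ∈ ℝ` with
`(∑_k e_k e^{−β e_k}) / (∑_k e^{−β e_k}) = ē`; and (ii) for this `β`, if `ε_N > 0` with
`ε_N → 0` and `N ε_N → ∞`, then the sets
`A_N = {x ∈ {e_1,…,e_K}^N : |N^{-1} ∑_i x_i − ē| ≤ ε_N}` are nonempty for all
sufficiently large `N`, and if `X` is sampled uniformly from `A_N`, then for every `k`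
the probability that `X_1 = e_k` converges, as `N → ∞`, to
`e^{−β e_k} / ∑_l e^{−β e_l}`; that is, the law of `X_1` converges weakly to the Gibbs
measure at inverse temperature `β`. -/
theorem equivalence_of_ensembles (K : ℕ) (hK : 2 ≤ K) (e : Fin K → ℝ)
    (he : StrictMono e) (ebar : ℝ)
    (hlo : e ⟨0, by omega⟩ < ebar) (hhi : ebar < e ⟨K - 1, by omega⟩) :
    (∃! β : ℝ,
      (∑ k : Fin K, e k * Real.exp (-β * e k)) / (∑ k : Fin K, Real.exp (-β * e k))
        = ebar) ∧
    ∀ β : ℝ,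
      (∑ k : Fin K, e k * Real.exp (-β * e k)) / (∑ k : Fin K, Real.exp (-β * e k))
        = ebar →
      ∀ ε : ℕ → ℝ, (∀ N, 0 < ε N) → Tendsto ε atTop (nhds 0) →
        Tendsto (fun N : ℕ => (N : ℝ) * ε N) atTop atTop →
        (∀ᶠ N : ℕ in atTop, (microcanonical K (N + 1) e ebar (ε (N + 1))).Nonempty) ∧
        ∀ k : Fin K,
          Tendsto (fun N : ℕ =>
              (((microcanonical K (N + 1) e ebar (ε (N + 1))).filter
                  fun x => x 0 = k).card : ℝ) /
                ((microcanonical K (N + 1) e ebar (ε (N + 1))).card : ℝ))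
            atTop
            (nhds (Real.exp (-β * e k) / ∑ l : Fin K, Real.exp (-β * e l))) := by
  have : Nonempty (Fin K) := ⟨⟨0, by omega⟩⟩
  have ha : e ⟨0, by omega⟩ - ebar < 0 := by linarith
  have hb : 0 < e ⟨K - 1, by omega⟩ - ebar := by linarith
  simp only [gibbs_mean_eq_iff]
  refine ⟨existsUnique_sum_mul_exp_eq_zero (fun k => e k - ebar) ha hb, ?_⟩
  intro β hβ ε _ hε hW
  have hZ : 0 < ∑ l, Real.exp (-β * e l) :=
    Finset.sum_pos (fun k _ => Real.exp_pos _) Finset.univ_nonempty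
  have hpf : ∀ k, Real.exp (-β * e k) / ∑ l, Real.exp (-β * e l) =
      Real.exp (-β * ebar) / (∑ l, Real.exp (-β * e l)) * Real.exp (-β * (e k - ebar)) := by
    intro k
    rw [div_mul_eq_mul_div, ← Real.exp_add]
    ring_nf
  have hc : 0 < Real.exp (-β * ebar) / ∑ l, Real.exp (-β * e l) := div_pos (Real.exp_pos _) hZ
  have h1 : ∑ k, Real.exp (-β * e k) / ∑ l, Real.exp (-β * e l) = 1 := by
    rw [← Finset.sum_div, div_self hZ.ne']
  have hm : ∑ k, (Real.exp (-β * e k) / ∑ l, Real.exp (-β * e l)) * (e k - ebar) = 0 := by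
    rw [← mul_zero (Real.exp (-β * ebar) / ∑ l, Real.exp (-β * e l)), ← hβ, Finset.mul_sum]
    refine Finset.sum_congr rfl fun k _ => ?_
    rw [hpf]
    ring
  simp only [microcanonical_eq_filter _ _ (Nat.succ_pos _)]
  exact ⟨(tendsto_add_atTop_nat 1).eventually (eventually_window_nonempty
      (fun k => div_pos (Real.exp_pos _) hZ) h1 hm ha hb hW),
    fun k => tendsto_marginal hc hpf h1 hm ha hb hε hW k⟩
end
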